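/- arXiv:2601.11131 — 2 statements merged into one kernel-verified Lean document; each statement's English description precedes it below -/
import Mathlib

section
/- For all real numbers x and y with x ≥ y ≥ 2 and x ≥ 4, the number Ψ(x, y) of y-smooth positive integers up to x satisfies Ψ(x, y) ≥ x / (log x)^(log x / log y). -/
/-- `Ψ x y` is the number of positive integers `n ≤ x` all of whose prime
factors `q` satisfy `q ≤ y`. -/
noncomputable def Psi (x y : ℝ) : ℕ :=
  Nat.card {n : ℕ | 0 < n ∧ (n : ℝ) ≤ x ∧ ∀ q : ℕ, q.Prime → q ∣ n → (q : ℝ) ≤ y}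

namespace SmoothAux

open Finset ArithmeticFunction Chebyshev

/-- smooth numbers as a finset -/
noncomputable def S (x y : ℝ) : Finset ℕ := by
  classical
  exact (Ioc 0 ⌊x⌋₊).filter (fun n => ∀ q : ℕ, q.Prime → q ∣ n → (q : ℝ) ≤ y)

lemma mem_S {x y : ℝ} (hx : 0 ≤ x) {n : ℕ} :
    n ∈ S x y ↔ 0 < n ∧ (n : ℝ) ≤ x ∧ ∀ q : ℕ, q.Prime → q ∣ n → (q : ℝ) ≤ y := by
  simp only [S, mem_filter, mem_Ioc, Nat.le_floor_iff hx, and_assoc]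

lemma Psi_eq {x y : ℝ} (hx : 0 ≤ x) : Psi x y = (S x y).card := by
  unfold Psi
  have : {n : ℕ | 0 < n ∧ (n : ℝ) ≤ x ∧ ∀ q : ℕ, q.Prime → q ∣ n → (q : ℝ) ≤ y}
      = (S x y : Set ℕ) := by
    ext n
    simp [mem_S hx]
  rw [this]
  simp

lemma le_Psi {x y : ℝ} (m : ℕ) (hx : (m : ℝ) ≤ x) (hy : (m : ℝ) ≤ y) : m ≤ Psi x y := by
  have hx0 : 0 ≤ x := le_trans (Nat.cast_nonneg m) hx
  rw [Psi_eq hx0]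
  have : Ioc 0 m ⊆ S x y := by
    intro n hn
    rw [mem_Ioc] at hn
    have hnm : (n : ℝ) ≤ m := by exact_mod_cast hn.2
    refine (mem_S hx0).2 ⟨hn.1, hnm.trans hx, fun q _ hqn => ?_⟩
    have : (q : ℝ) ≤ n := by exact_mod_cast Nat.le_of_dvd hn.1 hqn
    linarith
  simpa using card_le_card this

lemma three_le_Psi {x y : ℝ} (hx : 4 ≤ x) (hy : 2 ≤ y) : 3 ≤ Psi x y := by
  have hx0 : 0 ≤ x := by linarith
  rw [Psi_eq hx0]
  have : ({1, 2, 4} : Finset ℕ) ⊆ S x y := by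
    intro n hn
    simp only [mem_insert, mem_singleton] at hn
    rw [mem_S hx0]
    rcases hn with rfl | rfl | rfl
    · refine ⟨by norm_num, by norm_num; linarith, fun q hq hqn => ?_⟩
      exact absurd (Nat.dvd_one.1 hqn) hq.one_lt.ne'
    · refine ⟨by norm_num, by norm_num; linarith, fun q hq hqn => ?_⟩
      have : (q : ℝ) ≤ 2 := by exact_mod_cast Nat.le_of_dvd (by norm_num) hqn
      linarith
    · refine ⟨by norm_num, by norm_num; linarith, fun q hq hqn => ?_⟩
      have h2 : q ∣ 2 := by
        have : q ∣ 2 ^ 2 := by simpa using hqn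
        exact hq.dvd_of_dvd_pow this
      have : (q : ℝ) ≤ 2 := by exact_mod_cast Nat.le_of_dvd (by norm_num) h2
      linarith
  exact card_le_card this

lemma sum_le_Psi_mul_log {x y : ℝ} (hx : 1 ≤ x) :
    ∑ d ∈ Ioc 0 ⌊y⌋₊, Λ d * (Psi (x / d) y : ℝ) ≤ (Psi x y : ℝ) * Real.log x := by
  classical
  have hx0 : 0 ≤ x := by linarith
  have h1 : ∑ n ∈ S x y, Real.log n ≤ (Psi x y : ℝ) * Real.log x := by
    rw [Psi_eq hx0, ← nsmul_eq_mul]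
    refine sum_le_card_nsmul _ _ _ fun n hn => ?_
    rw [mem_S hx0] at hn
    exact Real.log_le_log (by exact_mod_cast hn.1) hn.2.1
  refine le_trans ?_ h1
  have h2 : ∑ n ∈ S x y, ∑ d ∈ Ioc 0 ⌊y⌋₊, (if d ∣ n then Λ d else 0)
      ≤ ∑ n ∈ S x y, Real.log n := by
    refine sum_le_sum fun n hn => ?_
    rw [mem_S hx0] at hn
    rw [← vonMangoldt_sum, ← sum_filter]
    refine sum_le_sum_of_subset_of_nonneg ?_ fun _ _ _ => vonMangoldt_nonneg
    intro d hd
    rw [mem_filter] at hd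
    exact Nat.mem_divisors.2 ⟨hd.2, hn.1.ne'⟩
  refine le_trans ?_ h2
  rw [sum_comm]
  refine sum_le_sum fun d hd => ?_
  rw [mem_Ioc] at hd
  have hd0 : (0 : ℝ) < d := by exact_mod_cast hd.1
  have hdy : (d : ℝ) ≤ y := (Nat.le_floor_iff' hd.1.ne').1 hd.2
  rw [← sum_filter, sum_const, nsmul_eq_mul, mul_comm]
  refine mul_le_mul_of_nonneg_right ?_ vonMangoldt_nonneg
  rw [Psi_eq (by positivity)]
  norm_cast
  refine card_le_card_of_injOn (fun m => d * m) ?_ ?_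
  · intro m hm
    have hm' := (mem_S (x := x / d) (by positivity)).1 hm
    have : d * m ∈ S x y := by
      rw [mem_S hx0]
      refine ⟨Nat.mul_pos hd.1 hm'.1, ?_, fun q hq hqn => ?_⟩
      · push_cast
        have := hm'.2.1
        rw [le_div_iff₀ hd0] at this
        linarith
      · rcases (hq.dvd_mul).1 hqn with h | h
        · have : (q : ℝ) ≤ d := by exact_mod_cast Nat.le_of_dvd hd.1 h
          linarith
        · exact hm'.2.2 q hq h
    simp [this]
  · intro a _ b _ hab
    exact Nat.eq_of_mul_eq_mul_left hd.1 hab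

/-- partial sums of Λ cut at z -/
lemma sum_cut {y z : ℝ} (hzy : z ≤ y) (hz : 0 ≤ z) :
    ∑ d ∈ Ioc 0 ⌊y⌋₊, (if (d : ℝ) ≤ z then Λ d else 0) = psi z := by
  rw [← sum_filter, psi]
  congr 1
  ext d
  simp only [mem_filter, mem_Ioc, Nat.le_floor_iff hz, Nat.le_floor_iff (hz.trans hzy)]
  constructor
  · rintro ⟨⟨a, _⟩, b⟩; exact ⟨a, b⟩
  · rintro ⟨a, b⟩; exact ⟨⟨a, b.trans hzy⟩, b⟩

/-- `force n f` is `f n`, written so that the kernel evaluates `n` first. -/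
def force (n : ℕ) (f : ℕ → Bool) : Bool :=
  match n with
  | 0 => f 0
  | m + 1 => f (m + 1)

lemma force_eq (n : ℕ) (f : ℕ → Bool) : force n f = f n := by
  cases n <;> rfl

/-- Checks `a ^ (m + 1) ≤ b ^ (m + 1) * lcm(1, …, m)` for `fuel` consecutive values of `m`. -/
def chk (a b : ℕ) : ℕ → ℕ → ℕ → ℕ → ℕ → Bool
  | 0, _, _, _, _ => true
  | fuel + 1, n, l, p, q =>
    Nat.ble p (q * l) &&
      force (n + 1) fun n₁ => force (Nat.lcm l n₁) fun l₁ => force (a * p) fun p₁ =>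
        force (b * q) fun q₁ => chk a b fuel n₁ l₁ p₁ q₁

lemma lcmUpto_succ (n : ℕ) : Nat.lcmUpto (n + 1) = Nat.lcm (Nat.lcmUpto n) (n + 1) := by
  unfold Nat.lcmUpto
  rw [← Finset.insert_Icc_right_eq_Icc_add_one (by omega), Finset.lcm_insert]
  exact Nat.lcm_comm _ _

lemma chk_spec (a b fuel : ℕ) : ∀ n, chk a b fuel n (Nat.lcmUpto n) (a ^ (n + 1)) (b ^ (n + 1)) = true →
    ∀ m, n ≤ m → m < n + fuel → a ^ (m + 1) ≤ b ^ (m + 1) * Nat.lcmUpto m := by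
  induction fuel with
  | zero => intro n _ m h1 h2; omega
  | succ f ih =>
    intro n h m h1 h2
    simp only [chk, force_eq] at h
    rw [Bool.and_eq_true, Nat.ble_eq, ← lcmUpto_succ, ← pow_succ', ← pow_succ'] at h
    rcases h1.eq_or_lt with rfl | h3
    · exact h.1
    · exact ih (n + 1) h.2 m h3 (by omega)

lemma chk1 : ∀ m, 7 ≤ m → m < 7 + 30 → 11 ^ (m + 1) ≤ 6 ^ (m + 1) * Nat.lcmUpto m :=
  chk_spec 11 6 30 7 (by
    rw [show Nat.lcmUpto 7 = 420 by decide +kernel]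
    decide +kernel)

lemma chk2 : ∀ m, 28 ≤ m → m < 28 + 2500 → 9 ^ (m + 1) ≤ 4 ^ (m + 1) * Nat.lcmUpto m :=
  chk_spec 9 4 2500 28 (by
    rw [show Nat.lcmUpto 28 = 80313433200 by decide +kernel]
    decide +kernel)

lemma psi_of_chk {a b m : ℕ} (ha : 0 < a) (hb : 0 < b)
    (h : a ^ (m + 1) ≤ b ^ (m + 1) * Nat.lcmUpto m) :
    (m + 1 : ℝ) * Real.log (a / b) ≤ psi m := by
  rw [psi_eq_log_lcmUpto]
  have h' : ((a : ℝ)) ^ (m + 1) ≤ (b : ℝ) ^ (m + 1) * (Nat.lcmUpto m : ℝ) := by exact_mod_cast h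
  have ha' : (0 : ℝ) < a := by exact_mod_cast ha
  have hb' : (0 : ℝ) < b := by exact_mod_cast hb
  have : Real.log (((a : ℝ) / b) ^ (m + 1)) ≤ Real.log (Nat.lcmUpto m) := by
    refine Real.log_le_log (by positivity) ?_
    rw [div_pow, div_le_iff₀ (by positivity)]
    linarith
  rw [Real.log_pow] at this
  exact_mod_cast this

lemma log_ge_of_pow {n : ℝ} (hn : 0 < n) (p r : ℕ) (hr : 0 < r) (h : (2.7182818286 : ℝ) ^ p ≤ n ^ r) :
    (p / r : ℝ) ≤ Real.log n := by
  have hr' : (0 : ℝ) < r := by exact_mod_cast hr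
  rw [div_le_iff₀ hr', mul_comm, ← Real.log_pow, Real.le_log_iff_exp_le (by positivity)]
  refine le_trans ?_ h
  rw [← Real.exp_one_pow]
  gcongr
  exact Real.exp_one_lt_d9.le

lemma psi_ge_small (z : ℝ) (h1 : 28 ≤ z) (h2 : z < 2500) : 0.8 * z ≤ psi z := by
  rw [psi_eq_psi_coe_floor]
  have a1 : 28 ≤ ⌊z⌋₊ := Nat.le_floor (by exact_mod_cast h1)
  have a2 : ⌊z⌋₊ < 2500 := (Nat.floor_lt (by linarith)).2 (by exact_mod_cast h2)
  have := psi_of_chk (by norm_num) (by norm_num) (chk2 _ a1 (by omega))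
  have hl : (4 / 5 : ℝ) ≤ Real.log (9 / 4) := by
    have := log_ge_of_pow (n := 9 / 4) (by norm_num) 4 5 (by norm_num) (by norm_num)
    exact_mod_cast this
  have h3 := (Nat.lt_floor_add_one z).le
  push_cast at this
  nlinarith

lemma psi_ge_tiny (z : ℝ) (h1 : 7 ≤ z) (h2 : z < 28) : 0.6 * z ≤ psi z := by
  rw [psi_eq_psi_coe_floor]
  have a1 : 7 ≤ ⌊z⌋₊ := Nat.le_floor (by exact_mod_cast h1)
  have a2 : ⌊z⌋₊ < 28 := (Nat.floor_lt (by linarith)).2 (by exact_mod_cast h2)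
  have := psi_of_chk (by norm_num) (by norm_num) (chk1 _ a1 (by omega))
  have hl : (3 / 5 : ℝ) ≤ Real.log (11 / 6) := by
    have := log_ge_of_pow (n := 11 / 6) (by norm_num) 3 5 (by norm_num) (by norm_num)
    exact_mod_cast this
  have h3 := (Nat.lt_floor_add_one z).le
  push_cast at this
  nlinarith

lemma log_le_tangent (k : ℕ) {s c : ℝ} (hs : 0 < s) (hc : 0 < c) (hk : c ≤ 2.718 ^ k) :
    Real.log s ≤ k - 1 + s / c := by
  have he : c ≤ Real.exp k := by
    refine hk.trans ?_
    rw [← mul_one (k : ℝ), Real.exp_nat_mul]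
    gcongr
    linarith [Real.exp_one_gt_d9]
  have := Real.log_le_sub_one_of_pos (x := s / Real.exp k) (by positivity)
  rw [Real.log_div hs.ne' (Real.exp_pos _).ne', Real.log_exp] at this
  have : s / Real.exp k ≤ s / c := by gcongr
  linarith

lemma psi_ge_large (z : ℝ) (h : 2500 ≤ z) : 0.6931 * z - 9 - z / 2900 ≤ psi z := by
  have h1 := psi_ge' (x := z) (by linarith)
  have h2 := log_le_tangent 8 (s := z + 2) (c := 2900) (by linarith) (by norm_num) (by norm_num)
  have h3 := Real.log_two_gt_d9
  have h4 := Real.log_two_lt_d9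
  push_cast at h2
  nlinarith

lemma psi_ge_six (z : ℝ) (h : 7 ≤ z) : 0.6 * z ≤ psi z := by
  rcases lt_or_ge z 28 with h1 | h1
  · exact psi_ge_tiny z h h1
  rcases lt_or_ge z 2500 with h2 | h2
  · linarith [psi_ge_small z h1 h2]
  · linarith [psi_ge_large z h2]

lemma psi_upper (s : ℝ) (hs : 1 ≤ s) : psi s ≤ s * Real.log s := by
  refine (psi_le_primeCounting_mul_log' s).trans ?_
  refine mul_le_mul_of_nonneg_right ?_ (Real.log_nonneg hs)
  refine le_trans ?_ (Nat.floor_le (by linarith : 0 ≤ s))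
  have h : (Nat.primesLE ⌊s⌋₊).card ≤ (Ioc 0 ⌊s⌋₊).card := by
    refine card_le_card fun p hp => ?_
    have hp' := Nat.prime_of_mem_primesLE hp
    rw [mem_Ioc]
    exact ⟨hp'.pos, Nat.le_of_mem_primesLE hp⟩
  rw [Nat.primesLE_card_eq_primeCounting, Nat.card_Ioc] at h
  exact_mod_cast h

lemma psi_comb (y : ℝ) (hy : 28 ≤ y) : y ≤ 1.53 * psi y - 0.53 * psi (√y) := by
  have hs : 5 ≤ √y := Real.le_sqrt_of_sq_le (by linarith)
  have hsq : √y * √y = y := Real.mul_self_sqrt (by linarith)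
  set s := √y
  have h1 := psi_upper s (by linarith)
  rcases lt_or_ge y 2500 with h2 | h2
  · have h3 := psi_ge_small y hy h2
    have h4 := log_le_tangent 1 (s := s) (c := 2.718) (by linarith) (by norm_num) (by norm_num)
    push_cast at h4
    have h5 : s * Real.log s ≤ s * (s / 2.718) := by gcongr; linarith
    have h6 : s * (s / 2.718) = y / 2.718 := by rw [← hsq]; ring
    rw [h6] at h5
    have h7 : y / 2.718 ≤ 0.37 * y := by
      rw [div_le_iff₀ (by norm_num)]
      linarith
    linarith
  · have h3 := psi_ge_large y h2
    have hs : 50 ≤ s := Real.le_sqrt_of_sq_le (by linarith)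
    have h4 := log_le_tangent 4 (s := s) (c := 54) (by linarith) (by norm_num) (by norm_num)
    push_cast at h4
    have h5 : s * Real.log s ≤ s * (3 + s / 54) := by gcongr; linarith
    nlinarith

end SmoothAux

namespace SmoothAux

open Finset ArithmeticFunction Chebyshev

lemma target_eq {x y : ℝ} (hx : 1 < x) :
    x / Real.log x ^ (Real.log x / Real.log y)
      = Real.exp (Real.log x - Real.log x * Real.log (Real.log x) / Real.log y) := by
  have hL : 0 < Real.log x := Real.log_pos hx
  rw [Real.exp_sub, Real.exp_log (by linarith), Real.rpow_def_of_pos hL]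
  congr 2
  ring

lemma target_le_max {x y : ℝ} (hx : 1 < x) (hy : 1 < y) (m : ℕ) (hm : 0 < m)
    (h : y ≤ 2.718 * Real.log m * Real.log y) :
    x / Real.log x ^ (Real.log x / Real.log y) ≤ m := by
  rw [target_eq hx, ← Real.le_log_iff_exp_le (by exact_mod_cast hm)]
  have hL : 0 < Real.log x := Real.log_pos hx
  have hY : 0 < Real.log y := Real.log_pos hy
  set L := Real.log x
  have h1 := log_le_tangent 1 (s := y / L) (c := 2.718) (by positivity) (by norm_num) (by norm_num)
  rw [Real.log_div (by linarith) hL.ne'] at h1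
  push_cast at h1
  have h2 : L * (Real.log y - Real.log L) ≤ y / 2.718 := by
    calc L * (Real.log y - Real.log L) ≤ L * (y / L / 2.718) := by gcongr; linarith
      _ = y / 2.718 := by field_simp
  have h3 : y / 2.718 ≤ Real.log m * Real.log y := by
    rw [div_le_iff₀ (by norm_num)]; linarith
  have h4 : L - L * Real.log L / Real.log y = L * (Real.log y - Real.log L) / Real.log y := by
    field_simp
  rw [h4, div_le_iff₀ hY]
  linarith

lemma log_conc {a b K y : ℝ} (hK : 0 ≤ K) (ha : 0 < a) (hay : a ≤ y) (hyb : y ≤ b)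
    (h1 : a ≤ K * Real.log a) (h2 : b ≤ K * Real.log b) : y ≤ K * Real.log y := by
  have hc : ConcaveOn ℝ (Set.Ioi (0 : ℝ)) Real.log := strictConcaveOn_log_Ioi.concaveOn
  rcases hay.eq_or_lt with rfl | hay'
  · exact h1
  have hab : 0 < b - a := by linarith
  have := hc.2 (Set.mem_Ioi.2 ha) (Set.mem_Ioi.2 (by linarith : 0 < b))
    (div_nonneg (by linarith : 0 ≤ b - y) hab.le)
    (div_nonneg (by linarith : 0 ≤ y - a) hab.le) (by field_simp; ring)
  simp only [smul_eq_mul] at this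
  have e : (b - y) / (b - a) * a + (y - a) / (b - a) * b = y := by field_simp; ring
  rw [e] at this
  have e1 : 0 ≤ (b - y) / (b - a) := div_nonneg (by linarith) hab.le
  have e2 : 0 ≤ (y - a) / (b - a) := div_nonneg (by linarith) hab.le
  calc y = (b - y) / (b - a) * a + (y - a) / (b - a) * b := e.symm
    _ ≤ (b - y) / (b - a) * (K * Real.log a) + (y - a) / (b - a) * (K * Real.log b) := by gcongr
    _ = K * ((b - y) / (b - a) * Real.log a + (y - a) / (b - a) * Real.log b) := by ring
    _ ≤ K * Real.log y := by gcongr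

lemma caseA {x y : ℝ} (hyx : y ≤ x) (hy : 2 ≤ y) (hx : 4 ≤ x) (hy28 : y ≤ 28) :
    x / Real.log x ^ (Real.log x / Real.log y) ≤ (Psi x y : ℝ) := by
  have l2 : (69 / 100 : ℝ) ≤ Real.log 2 := by linarith [Real.log_two_gt_d9]
  have l3 : (109 / 100 : ℝ) ≤ Real.log 3 := by
    exact_mod_cast log_ge_of_pow (n := 3) (by norm_num) 109 100 (by norm_num) (by norm_num)
  have l4 : (138 / 100 : ℝ) ≤ Real.log 4 := by
    exact_mod_cast log_ge_of_pow (n := 4) (by norm_num) 138 100 (by norm_num) (by norm_num)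
  have l7 : (194 / 100 : ℝ) ≤ Real.log 7 := by
    exact_mod_cast log_ge_of_pow (n := 7) (by norm_num) 194 100 (by norm_num) (by norm_num)
  have l13 : (256 / 100 : ℝ) ≤ Real.log 13 := by
    exact_mod_cast log_ge_of_pow (n := 13) (by norm_num) 256 100 (by norm_num) (by norm_num)
  have l20 : (149 / 50 : ℝ) ≤ Real.log 20 := by
    exact_mod_cast log_ge_of_pow (n := 20) (by norm_num) 149 50 (by norm_num) (by norm_num)
  have l26 : (13 / 4 : ℝ) ≤ Real.log 26 := by
    exact_mod_cast log_ge_of_pow (n := 26) (by norm_num) 13 4 (by norm_num) (by norm_num)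
  have l28 : (83 / 25 : ℝ) ≤ Real.log 28 := by
    exact_mod_cast log_ge_of_pow (n := 28) (by norm_num) 83 25 (by norm_num) (by norm_num)
  have key : ∀ (m : ℕ) (a b : ℝ), 2 ≤ m → 0 < a → a ≤ y → y ≤ b →
      a ≤ 2.718 * Real.log m * Real.log a → b ≤ 2.718 * Real.log m * Real.log b →
      m ≤ Psi x y → x / Real.log x ^ (Real.log x / Real.log y) ≤ (Psi x y : ℝ) := by
    intro m a b hm ha hay hyb h1 h2 h3
    have hm1 : (1 : ℝ) ≤ m := by exact_mod_cast (by omega : 1 ≤ m)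
    refine (target_le_max (by linarith) (by linarith) m (by omega) ?_).trans
      (by exact_mod_cast h3)
    exact log_conc (mul_nonneg (by norm_num) (Real.log_nonneg hm1)) ha hay hyb h1 h2
  rcases le_or_gt y 4 with h4 | h4
  · exact key 3 2 4 (by norm_num) (by norm_num) hy h4 (by push_cast; nlinarith)
      (by push_cast; nlinarith) (three_le_Psi hx hy)
  rcases le_or_gt y 7 with h7 | h7
  · exact key 4 4 7 (by norm_num) (by norm_num) h4.le h7 (by push_cast; nlinarith)
      (by push_cast; nlinarith) (le_Psi 4 (by push_cast; linarith) (by push_cast; linarith))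
  rcases le_or_gt y 13 with h13 | h13
  · exact key 7 7 13 (by norm_num) (by norm_num) h7.le h13 (by push_cast; nlinarith)
      (by push_cast; nlinarith) (le_Psi 7 (by push_cast; linarith) (by push_cast; linarith))
  rcases le_or_gt y 20 with h20 | h20
  · exact key 13 13 20 (by norm_num) (by norm_num) h13.le h20 (by push_cast; nlinarith)
      (by push_cast; nlinarith) (le_Psi 13 (by push_cast; linarith) (by push_cast; linarith))
  rcases le_or_gt y 26 with h26 | h26
  · exact key 20 20 26 (by norm_num) (by norm_num) h20.le h26 (by push_cast; nlinarith)
      (by push_cast; nlinarith) (le_Psi 20 (by push_cast; linarith) (by push_cast; linarith))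
  · exact key 26 26 28 (by norm_num) (by norm_num) h26.le hy28 (by push_cast; nlinarith)
      (by push_cast; nlinarith) (le_Psi 26 (by push_cast; linarith) (by push_cast; linarith))

lemma log_ge_332 {y : ℝ} (hy : 28 ≤ y) : 3.32 ≤ Real.log y := by
  have l28 : (83 / 25 : ℝ) ≤ Real.log 28 := by
    exact_mod_cast log_ge_of_pow (n := 28) (by norm_num) 83 25 (by norm_num) (by norm_num)
  have := Real.log_le_log (by norm_num) hy
  linarith

lemma mid_sum {x y : ℝ} (hy : 28 ≤ y) (hyx : y ≤ x) (h4 : 4 * (x / y) ≤ y) :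
    0.6 * y * (2 * (x / y) - 1) ≤ (Psi x y : ℝ) * Real.log x := by
  have hy0 : 0 < y := by linarith
  have hv1 : 1 ≤ x / y := by rw [le_div_iff₀ hy0]; linarith
  refine le_trans ?_ (sum_le_Psi_mul_log (y := y) (by linarith : 1 ≤ x))
  set v := x / y with hv
  have hxv : x = v * y := by rw [hv]; field_simp
  set n1 := ⌊v⌋₊
  set n2 := ⌊2 * v⌋₊
  set n4 := ⌊4 * v⌋₊
  have f1 : (n1 : ℝ) ≤ v := Nat.floor_le (by linarith)
  have f2 : (n2 : ℝ) ≤ 2 * v := Nat.floor_le (by linarith)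
  have f4 : (n4 : ℝ) ≤ 4 * v := Nat.floor_le (by linarith)
  have g1 : v - 1 ≤ (n1 : ℝ) := (Nat.sub_one_lt_floor v).le
  have g2 : 2 * v - 1 ≤ (n2 : ℝ) := (Nat.sub_one_lt_floor _).le
  have g4 : 4 * v - 1 ≤ (n4 : ℝ) := (Nat.sub_one_lt_floor _).le
  have m12 : (n1 : ℝ) ≤ n2 := by exact_mod_cast Nat.floor_mono (by linarith)
  have m24 : (n2 : ℝ) ≤ n4 := by exact_mod_cast Nat.floor_mono (by linarith)
  have key : ∀ d ∈ Ioc 0 ⌊y⌋₊,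
      (n1 : ℝ) * (if (d : ℝ) ≤ y then Λ d else 0) + ((n2 : ℝ) - n1) * (if (d : ℝ) ≤ y / 2 then Λ d else 0)
        + ((n4 : ℝ) - n2) * (if (d : ℝ) ≤ y / 4 then Λ d else 0) ≤ Λ d * (Psi (x / d) y : ℝ) := by
    intro d hd
    rw [mem_Ioc] at hd
    have hd0 : (0 : ℝ) < d := by exact_mod_cast hd.1
    have hdy : (d : ℝ) ≤ y := (Nat.le_floor_iff' hd.1.ne').1 hd.2
    have hL : 0 ≤ Λ d := vonMangoldt_nonneg
    have hP : ∀ (m : ℕ) (c : ℝ), 0 < c → (m : ℝ) ≤ c * v → (m : ℝ) ≤ y → (d : ℝ) ≤ y / c →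
        (m : ℝ) ≤ (Psi (x / d) y : ℝ) := by
      intro m c hc h1 h2 h3
      have : m ≤ Psi (x / d) y := by
        refine le_Psi m ?_ h2
        rw [le_div_iff₀ hd0]
        calc (m : ℝ) * d ≤ (c * v) * (y / c) := by gcongr
          _ = x := by rw [hxv]; field_simp
      exact_mod_cast this
    have q1 := hP n1 1 (by norm_num) (by linarith) (by linarith) (by linarith)
    rw [if_pos hdy]
    split_ifs with a b b
    · have q4 := hP n4 4 (by norm_num) f4 (by linarith) b
      nlinarith
    · have q2 := hP n2 2 (by norm_num) f2 (by linarith) a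
      nlinarith
    · exfalso; linarith
    · nlinarith
  refine le_trans ?_ (sum_le_sum key)
  rw [sum_add_distrib, sum_add_distrib, ← mul_sum, ← mul_sum, ← mul_sum, sum_cut le_rfl hy0.le,
    sum_cut (by linarith) (by linarith), sum_cut (by linarith) (by linarith)]
  have p1 := psi_ge_six y (by linarith)
  have p2 := psi_ge_six (y / 2) (by linarith)
  have p4 := psi_ge_six (y / 4) (by linarith)
  have r1 : (n1 : ℝ) * (0.6 * y) ≤ n1 * psi y := by gcongr
  have r2 : ((n2 : ℝ) - n1) * (0.6 * (y / 2)) ≤ (n2 - n1) * psi (y / 2) :=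
    mul_le_mul_of_nonneg_left p2 (by linarith)
  have r4 : ((n4 : ℝ) - n2) * (0.6 * (y / 4)) ≤ (n4 - n2) * psi (y / 4) :=
    mul_le_mul_of_nonneg_left p4 (by linarith)
  nlinarith

lemma high_sum {x y : ℝ} (hy : 28 ≤ y) (hyx : y ≤ x) (h4 : x / y ≤ y) :
    0.6 * y * (x / y - 1) ≤ (Psi x y : ℝ) * Real.log x := by
  have hy0 : 0 < y := by linarith
  have hv1 : 1 ≤ x / y := by rw [le_div_iff₀ hy0]; linarith
  refine le_trans ?_ (sum_le_Psi_mul_log (y := y) (by linarith : 1 ≤ x))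
  set v := x / y with hv
  have hxv : x = v * y := by rw [hv]; field_simp
  set n1 := ⌊v⌋₊
  have f1 : (n1 : ℝ) ≤ v := Nat.floor_le (by linarith)
  have g1 : v - 1 ≤ (n1 : ℝ) := (Nat.sub_one_lt_floor v).le
  have key : ∀ d ∈ Ioc 0 ⌊y⌋₊, Λ d * (n1 : ℝ) ≤ Λ d * (Psi (x / d) y : ℝ) := by
    intro d hd
    rw [mem_Ioc] at hd
    have hd0 : (0 : ℝ) < d := by exact_mod_cast hd.1
    have hdy : (d : ℝ) ≤ y := (Nat.le_floor_iff' hd.1.ne').1 hd.2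
    refine mul_le_mul_of_nonneg_left ?_ vonMangoldt_nonneg
    have : n1 ≤ Psi (x / d) y := by
      refine le_Psi n1 ?_ (by linarith)
      rw [le_div_iff₀ hd0]
      calc (n1 : ℝ) * d ≤ v * y := by gcongr
        _ = x := hxv.symm
    exact_mod_cast this
  refine le_trans ?_ (sum_le_sum key)
  rw [← sum_mul]
  change _ ≤ psi y * _
  have p1 := psi_ge_six y (by linarith)
  calc 0.6 * y * (v - 1) ≤ psi y * (v - 1) := by gcongr
    _ ≤ psi y * n1 := by gcongr

lemma caseB {x y : ℝ} (hyx : y ≤ x) (hy : 28 ≤ y) (hx2 : x ≤ y ^ 2) :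
    x / Real.log x ^ (Real.log x / Real.log y) ≤ (Psi x y : ℝ) := by
  have hy0 : 0 < y := by linarith
  have hx0 : 0 < x := by linarith
  have hY := log_ge_332 hy
  have hYL : Real.log y ≤ Real.log x := Real.log_le_log hy0 hyx
  have hL0 : 0 < Real.log x := by linarith
  have hv0 : 0 < x / y := by positivity
  have hlv : Real.log (x / y) = Real.log x - Real.log y := Real.log_div hx0.ne' hy0.ne'
  have hpow1 : Real.log x ≤ Real.log x ^ (Real.log x / Real.log y) := by
    conv_lhs => rw [← Real.rpow_one (Real.log x)]
    refine Real.rpow_le_rpow_of_exponent_le (by linarith) ?_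
    rw [le_div_iff₀ (by linarith)]; linarith
  have hxv : x = x / y * y := by field_simp
  set v := x / y with hv
  rcases le_or_gt v 3 with h3 | h3
  · rw [div_le_iff₀ (by positivity)]
    have hP : ((⌊y⌋₊ : ℕ) : ℝ) ≤ (Psi x y : ℝ) := by
      have := le_Psi (x := x) (y := y) ⌊y⌋₊ ((Nat.floor_le hy0.le).trans hyx) (Nat.floor_le hy0.le)
      exact_mod_cast this
    have hf : y - 1 ≤ (⌊y⌋₊ : ℝ) := (Nat.sub_one_lt_floor y).le
    have : (y - 1) * 3.32 ≤ (Psi x y : ℝ) * Real.log x ^ (Real.log x / Real.log y) := by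
      gcongr <;> linarith
    nlinarith
  rcases le_or_gt (4 * v) y with h4 | h4
  · have := mid_sum hy hyx h4
    rw [div_le_iff₀ (by positivity)]
    have h5 : (Psi x y : ℝ) * Real.log x ≤ (Psi x y : ℝ) * Real.log x ^ (Real.log x / Real.log y) := by
      gcongr
    rw [← hv] at this
    nlinarith
  · have hvy : v ≤ y := by rw [hv, div_le_iff₀ hy0]; linarith
    have := high_sum hy hyx hvy
    rw [← hv] at this
    rw [div_le_iff₀ (by positivity)]
    have hlv2 : Real.log y / 2 ≤ Real.log v := by
      have : Real.log (√y) ≤ Real.log v := by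
        refine Real.log_le_log (by positivity) ?_
        have hs : 5 ≤ √y := Real.le_sqrt_of_sq_le (by linarith)
        have hsq : √y * √y = y := Real.mul_self_sqrt (by linarith)
        nlinarith
      rwa [Real.log_sqrt hy0.le] at this
    have hpow2 : Real.log x * 2 ≤ Real.log x ^ (Real.log x / Real.log y) := by
      have e1 : Real.log x ^ ((1 : ℝ) + 1 / 2) ≤ Real.log x ^ (Real.log x / Real.log y) := by
        refine Real.rpow_le_rpow_of_exponent_le (by linarith) ?_
        rw [le_div_iff₀ (by linarith)]; linarith
      refine le_trans ?_ e1
      rw [Real.rpow_add hL0, Real.rpow_one, ← Real.sqrt_eq_rpow]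
      gcongr
      refine Real.le_sqrt_of_sq_le ?_
      linarith
    have h5 : (Psi x y : ℝ) * (Real.log x * 2) ≤ (Psi x y : ℝ) * Real.log x ^ (Real.log x / Real.log y) := by
      gcongr
    nlinarith

lemma caseC_real {L Y l : ℝ} (hY : 0 < Y) (hL : 2 * Y ≤ L) (hlog : Real.log L ≤ Y) (hl0 : 0 ≤ l)
    (hl : l ≤ Y) (E : ℝ) (hE : E ≤ l / Y * (2 * (L - l) / (2 * L - l))) :
    L * Real.exp (L - L * Real.log L / Y) * (Real.exp (-Y) * Real.exp E)
      ≤ Real.exp ((L - l) - (L - l) * Real.log (L - l) / Y) := by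
  have hL0 : 0 < L := by linarith
  have hLl : 0 < L - l := by linarith
  have h1 : Real.log L = Real.log (L - l) + Real.log (1 + l / (L - l)) := by
    rw [← Real.log_mul hLl.ne' (by positivity)]
    congr 1
    field_simp
    ring
  have h2 := Real.le_log_one_add_of_nonneg (x := l / (L - l)) (by positivity)
  have h3 : 2 * (l / (L - l)) / (l / (L - l) + 2) = 2 * l / (2 * L - l) := by
    have : 0 < 2 * L - l := by linarith
    have e : l / (L - l) + 2 = (2 * L - l) / (L - l) := by field_simp; ring
    rw [e]
    field_simp
  rw [h3] at h2
  have h4 : (L - l) / Y * (2 * l / (2 * L - l)) ≤ (L - l) / Y * (Real.log L - Real.log (L - l)) := by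
    gcongr
    linarith
  have h5 : (L - l) / Y * (2 * l / (2 * L - l)) = l / Y * (2 * (L - l) / (2 * L - l)) := by ring
  nth_rewrite 1 [← Real.exp_log hL0]
  rw [← Real.exp_add, ← Real.exp_add, ← Real.exp_add, Real.exp_le_exp]
  have h6 : (Y - l) * (Real.log L - Y) / Y ≤ 0 := by
    refine div_nonpos_of_nonpos_of_nonneg ?_ hY.le
    exact mul_nonpos_of_nonneg_of_nonpos (by linarith) (by linarith)
  have h7 : (Real.log L + (L - L * Real.log L / Y) + (-Y + (L - l) / Y * (Real.log L - Real.log (L - l))))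
      - ((L - l) - (L - l) * Real.log (L - l) / Y) = (Y - l) * (Real.log L - Y) / Y := by
    field_simp
    ring
  linarith

lemma caseC_exp {L Y l : ℝ} (hY : 0 < Y) (hL : 2 * Y ≤ L) (hl0 : Y / 2 ≤ l) (hl : l ≤ Y) :
    3 / 7 ≤ l / Y * (2 * (L - l) / (2 * L - l)) := by
  have h1 : 0 < 2 * L - l := by linarith
  rw [div_mul_div_comm, div_le_div_iff₀ (by norm_num) (by positivity)]
  nlinarith [mul_nonneg (sub_nonneg.2 hL) (by linarith : 0 ≤ 28 * l - 6 * Y),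
    mul_nonneg (by linarith : 0 ≤ 2 * l - Y) (by linarith : 0 ≤ 12 * Y - 7 * l),
    mul_nonneg (sub_nonneg.2 hL) (by linarith : 0 ≤ l - Y / 2)]

lemma exp_37 : (1.53 : ℝ) ≤ Real.exp (3 / 7) := by
  have := Real.sum_le_exp_of_nonneg (x := 3 / 7) (by norm_num) 4
  refine le_trans ?_ this
  norm_num [Finset.sum_range_succ, Nat.factorial]

lemma caseC {x y : ℝ} (hy : 28 ≤ y) (hx2 : y ^ 2 ≤ x)
    (ih : ∀ d : ℕ, 2 ≤ d → (d : ℝ) ≤ y →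
      (x / d) / Real.log (x / d) ^ (Real.log (x / d) / Real.log y) ≤ (Psi (x / d) y : ℝ)) :
    x / Real.log x ^ (Real.log x / Real.log y) ≤ (Psi x y : ℝ) := by
  have hy0 : 0 < y := by linarith
  have hyx : y ≤ x := by nlinarith
  have hx0 : 0 < x := by linarith
  have hY := log_ge_332 hy
  have hL2 : 2 * Real.log y ≤ Real.log x := by
    have := Real.log_le_log (by positivity) hx2
    rwa [Real.log_pow, Nat.cast_ofNat] at this
  have hL0 : 0 < Real.log x := by linarith
  have hY0 : 0 < Real.log y := by linarith
  rcases le_or_gt y (Real.log x) with hbig | hbig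
  · have h1 : (1 : ℝ) ≤ (Psi x y : ℝ) := by
      have := le_Psi (x := x) (y := y) 1 (by push_cast; linarith) (by push_cast; linarith)
      exact_mod_cast this
    refine le_trans ?_ h1
    rw [target_eq (by linarith), Real.exp_le_one_iff]
    have h2 : Real.log y ≤ Real.log (Real.log x) := Real.log_le_log hy0 hbig
    have : Real.log x ≤ Real.log x * Real.log (Real.log x) / Real.log y := by
      rw [le_div_iff₀ hY0]
      gcongr
    linarith
  have hlog : Real.log (Real.log x) ≤ Real.log y := Real.log_le_log hL0 hbig.le
  have hsum := sum_le_Psi_mul_log (y := y) (by linarith : 1 ≤ x)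
  rw [target_eq (by linarith)]
  set T := Real.exp (Real.log x - Real.log x * Real.log (Real.log x) / Real.log y) with hT
  have hT0 : 0 < T := Real.exp_pos _
  have hey : Real.exp (-Real.log y) = 1 / y := by rw [Real.exp_neg, Real.exp_log hy0, one_div]
  have hsq0 : √y ≤ y := by
    have hs : 5 ≤ √y := Real.le_sqrt_of_sq_le (by linarith)
    have hsq : √y * √y = y := Real.mul_self_sqrt (by linarith)
    nlinarith
  have key : ∀ d ∈ Ioc 0 ⌊y⌋₊,
      (Real.log x * T / y) * (1.53 * (if (d : ℝ) ≤ y then Λ d else 0)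
        - 0.53 * (if (d : ℝ) ≤ √y then Λ d else 0)) ≤ Λ d * (Psi (x / d) y : ℝ) := by
    intro d hd
    rw [mem_Ioc] at hd
    have hd0 : (0 : ℝ) < d := by exact_mod_cast hd.1
    have hdy : (d : ℝ) ≤ y := (Nat.le_floor_iff' hd.1.ne').1 hd.2
    rcases Nat.eq_or_lt_of_le hd.1 with h1 | h1
    · have : d = 1 := by omega
      subst this
      simp
    have hih := ih d h1 hdy
    have hd1 : (1 : ℝ) ≤ d := by exact_mod_cast hd.1
    have hxd : 1 < x / d := by rw [lt_div_iff₀ hd0]; nlinarith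
    rw [target_eq hxd, Real.log_div hx0.ne' hd0.ne'] at hih
    have hl0 : 0 ≤ Real.log d := Real.log_nonneg hd1
    have hlY : Real.log d ≤ Real.log y := Real.log_le_log hd0 hdy
    have hL : 0 ≤ Λ d := vonMangoldt_nonneg
    have fin : ∀ E w : ℝ, w ≤ Real.exp E →
        E ≤ Real.log d / Real.log y * (2 * (Real.log x - Real.log d) / (2 * Real.log x - Real.log d)) →
        (Real.log x * T / y) * (w * Λ d) ≤ Λ d * (Psi (x / d) y : ℝ) := by
      intro E w hw hE
      have := (caseC_real hY0 hL2 hlog hl0 hlY E hE).trans hih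
      rw [hey] at this
      have h2 : Real.log x * T * (1 / y * w) ≤ (Psi (x / d) y : ℝ) := by
        refine le_trans ?_ this
        gcongr
      calc (Real.log x * T / y) * (w * Λ d) = Λ d * (Real.log x * T * (1 / y * w)) := by ring
        _ ≤ _ := by gcongr
    rw [if_pos hdy]
    split_ifs with a
    · have := fin 0 1 (by simp) (by
        have : 0 < 2 * Real.log x - Real.log d := by linarith
        have : 0 < Real.log x - Real.log d := by linarith
        positivity)
      refine le_trans (le_of_eq ?_) this
      ring
    · have := fin (3 / 7) 1.53 exp_37 (by
        refine caseC_exp hY0 hL2 ?_ hlY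
        rw [← Real.log_sqrt hy0.le]
        exact Real.log_le_log (by positivity) (not_le.1 a).le)
      refine le_trans (le_of_eq ?_) this
      ring
  have h1 := (sum_le_sum key).trans hsum
  rw [← mul_sum, sum_sub_distrib, ← mul_sum, ← mul_sum, sum_cut le_rfl hy0.le,
    sum_cut hsq0 (by positivity)] at h1
  have h2 := psi_comb y hy
  have h3 : Real.log x * T / y * y ≤ (Psi x y : ℝ) * Real.log x := by
    refine le_trans ?_ h1
    gcongr
  rw [div_mul_cancel₀ _ hy0.ne', mul_comm] at h3
  exact le_of_mul_le_mul_right h3 hL0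

lemma main_ind (y : ℝ) (hy : 28 ≤ y) : ∀ (n : ℕ) (x : ℝ), x ≤ n → y ≤ x →
    x / Real.log x ^ (Real.log x / Real.log y) ≤ (Psi x y : ℝ) := by
  intro n
  induction n with
  | zero => intro x hx hyx; push_cast at hx; linarith
  | succ n ih =>
    intro x hx hyx
    rcases le_or_gt x (y ^ 2) with h | h
    · exact caseB hyx hy h
    · refine caseC hy h.le fun d hd hdy => ih _ ?_ ?_
      · have h2 : (2 : ℝ) ≤ d := by exact_mod_cast hd
        push_cast at hx
        rw [div_le_iff₀ (by linarith)]
        nlinarith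
      · have h2 : (2 : ℝ) ≤ d := by exact_mod_cast hd
        rw [le_div_iff₀ (by linarith)]
        nlinarith

end SmoothAux

/-- Lower bound for the count of `y`-smooth numbers up to `x`:
for `x ≥ y ≥ 2` and `x ≥ 4`, `Ψ(x,y) ≥ x / (log x)^(log x / log y)`. -/
theorem smooth_count_lower_bound (x y : ℝ) (hyx : y ≤ x) (hy : 2 ≤ y) (hx : 4 ≤ x) :
    x / Real.log x ^ (Real.log x / Real.log y) ≤ (Psi x y : ℝ) := by
  rcases le_or_gt y 28 with h | h
  · exact SmoothAux.caseA hyx hy hx h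
  · obtain ⟨n, hn⟩ := exists_nat_ge x
    exact SmoothAux.main_ind y h.le n x hn hyx
end

section
/- For every real ε > 0 there exists a constant C > 0 such that for every prime p, the least primitive root g(p) modulo p satisfies g(p) ≤ C · p^(1/4 + ε). -/
/-- The least primitive root modulo `p`: the least integer `g` with `1 ≤ g < p`
whose residue class generates the multiplicative group modulo `p`, i.e. whose
powers hit every nonzero residue. -/
noncomputable def leastPrimitiveRoot (p : ℕ) : ℕ :=
  sInf {g : ℕ | 1 ≤ g ∧ g < p ∧ ∀ x : ZMod p, x ≠ 0 → ∃ k : ℕ, (g : ZMod p) ^ k = x}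



open Polynomial in
/-- The polynomial factor of the iterated derivative of `f ^ e * r`. -/
noncomputable def stepRho {F : Type*} [Field F] (f : F[X]) (e : ℕ) : ℕ → (F[X] →ₗ[F] F[X])
  | 0 => LinearMap.id
  | l + 1 => (LinearMap.mulLeft F f) ∘ₗ derivative ∘ₗ (stepRho f e l)
      + ((e : F) - (l : F)) • ((LinearMap.mulLeft F (derivative f)) ∘ₗ (stepRho f e l))

open Polynomial in
lemma stepRho_succ {F : Type*} [Field F] (f : F[X]) (e l : ℕ) (r : F[X]) :
    stepRho f e (l + 1) r = f * derivative (stepRho f e l r)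
      + C ((e : F) - (l : F)) * (derivative f * stepRho f e l r) := by
  simp [stepRho, smul_eq_C_mul]

open Polynomial in
lemma stepRho_natDegree {F : Type*} [Field F] (f : F[X]) (e m : ℕ) (hm : f.natDegree ≤ m)
    (r : F[X]) (l : ℕ) :
    (stepRho f e l r).natDegree ≤ r.natDegree + l * m := by
  induction l with
  | zero => simp [stepRho]
  | succ l ih =>
    rw [stepRho_succ]
    refine natDegree_add_le_of_degree_le ?_ ?_
    · refine natDegree_mul_le.trans ?_
      have := natDegree_derivative_le (stepRho f e l r)
      rw [add_mul]
      omega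
    · refine (natDegree_C_mul_le _ _).trans (natDegree_mul_le.trans ?_)
      have := natDegree_derivative_le f
      rw [add_mul]
      omega

open Polynomial in
lemma stepRho_deriv {p : ℕ} [Fact p.Prime] (f r : (ZMod p)[X]) (e k l : ℕ) (hl : l ≤ e) :
    derivative^[l] (f ^ e * r * X ^ (p * k)) =
      f ^ (e - l) * stepRho f e l r * X ^ (p * k) := by
  induction l with
  | zero => simp [stepRho]
  | succ l ih =>
    rw [Function.iterate_succ_apply', ih (by omega), stepRho_succ]
    have h1 : e - l = (e - (l + 1)) + 1 := by omega
    have h2 : ((e : ZMod p) - (l : ZMod p)) = ((e - (l + 1) + 1 : ℕ) : ZMod p) := by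
      rw [← h1, Nat.cast_sub (by omega)]
    have h3 : derivative (X ^ (p * k) : (ZMod p)[X]) = 0 := by
      simp [derivative_X_pow]
    rw [derivative_mul, h3, mul_zero, add_zero, derivative_mul, h2, h1, derivative_pow]
    simp only [Nat.add_sub_cancel, map_natCast]
    ring

open Polynomial in
/-- Nonvanishing of the auxiliary polynomial. -/
lemma step_nonvanish {F : Type*} [Field F] (h : F[X]) (hh : h.eval 0 ≠ 0) (D n N : ℕ)
    (s : ℕ → F[X]) (hs : ∀ t, (s t).degree < n)
    (hsum : ∑ t ∈ Finset.range N, (X * h) ^ (n * (t % D)) * s t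
      * X ^ ((n * D + 1) * (t / D)) = 0) :
    ∀ t < N, s t = 0 := by
  have hX : ¬ (X : F[X]) ∣ h := by
    rw [X_dvd_iff, coeff_zero_eq_eval_zero]; exact hh
  have key : ∀ t, (X * h) ^ (n * (t % D)) * s t * X ^ ((n * D + 1) * (t / D))
      = X ^ (n * t + t / D) * (s t * h ^ (n * (t % D))) := by
    intro t
    have : n * t + t / D = n * (t % D) + (n * D + 1) * (t / D) := by
      have h0 := congrArg (fun z => n * z) (Nat.mod_add_div t D)
      simp only [mul_add] at h0
      rw [← h0]; ring
    rw [this, pow_add, mul_pow]; ring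
  simp only [key] at hsum
  intro t
  induction t using Nat.strong_induction_on with
  | _ t ih =>
    intro ht
    have hdvd : (X : F[X]) ^ (n * t + t / D + n) ∣
        X ^ (n * t + t / D) * (s t * h ^ (n * (t % D))) := by
      rw [← Finset.add_sum_erase _ _ (Finset.mem_range.2 ht)] at hsum
      rw [eq_neg_of_add_eq_zero_left hsum]
      refine (dvd_neg.2 (Finset.dvd_sum ?_))
      intro t' ht'
      rw [Finset.mem_erase, Finset.mem_range] at ht'
      rcases lt_or_gt_of_ne ht'.1 with hlt | hlt
      · rw [ih t' hlt ht'.2]; simp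
      · refine Dvd.dvd.mul_right (pow_dvd_pow _ ?_) _
        have h1 : t / D ≤ t' / D := Nat.div_le_div_right hlt.le
        have h2 : n * (t + 1) ≤ n * t' := Nat.mul_le_mul_left _ hlt
        rw [mul_add] at h2
        omega
    rw [pow_add, mul_dvd_mul_iff_left (pow_ne_zero _ X_ne_zero)] at hdvd
    have h3 : ¬ (X : F[X]) ∣ h ^ (n * (t % D)) := fun h4 => hX (prime_X.dvd_of_dvd_pow h4)
    have h5 := prime_X.pow_dvd_of_dvd_mul_right n h3 hdvd
    by_contra hne
    have h6 := degree_le_of_dvd h5 hne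
    rw [degree_X_pow] at h6
    exact absurd (hs t) (not_lt.2 h6)

open Polynomial in
lemma sum_mult_le {F : Type*} [Field F] [DecidableEq F] (P : F[X]) (S : Finset F)
    (M : ℕ) (hS : ∀ x ∈ S, M ≤ P.rootMultiplicity x) : S.card * M ≤ P.natDegree := by
  calc S.card * M = ∑ x ∈ S, M := by simp
    _ ≤ ∑ x ∈ S, P.roots.count x := Finset.sum_le_sum fun x hx => by
        rw [count_roots]; exact hS x hx
    _ ≤ ∑ x ∈ S ∪ P.roots.toFinset, P.roots.count x :=
        Finset.sum_le_sum_of_subset Finset.subset_union_left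
    _ = P.roots.card := Multiset.sum_count_eq_card fun x hx => by simp_all
    _ ≤ P.natDegree := card_roots' P

open Polynomial in
/-- Stepanov's method, raw form. -/
lemma stepanov_raw {p : ℕ} [Fact p.Prime] (h : (ZMod p)[X]) (hh : h.eval 0 ≠ 0)
    (D n m M K : ℕ) (hD : 0 < D) (hDn : n * D + 1 = p) (hm : (X * h).natDegree ≤ m)
    (hM : M ≤ p) (hineq : M * (n + K + M * m) < D * K * n)
    (a : ZMod p) (S : Finset (ZMod p)) (hS : ∀ x ∈ S, ((X * h).eval x) ^ n = a) :
    S.card * M ≤ M * m + p * m + p * K := by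
  classical
  set f : (ZMod p)[X] := X * h with hf
  set W := n + K + M * m with hW
  let V := Fin (D * K) → degreeLT (ZMod p) n
  let P : ℕ → V →ₗ[ZMod p] (ZMod p)[X] := fun l =>
    ∑ t : Fin (D * K), (LinearMap.mulLeft (ZMod p) (C (a ^ (t.val % D)) * X ^ (t.val / D)))
      ∘ₗ (stepRho f (M + n * (t.val % D)) l) ∘ₗ (Submodule.subtype _) ∘ₗ (LinearMap.proj t)
  have hP : ∀ l v, P l v = ∑ t : Fin (D * K), C (a ^ (t.val % D)) * X ^ (t.val / D) *
      stepRho f (M + n * (t.val % D)) l (v t : (ZMod p)[X]) := by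
    intro l v
    simp only [P, LinearMap.sum_apply]
    rfl
  let Λ : V →ₗ[ZMod p] (Fin M → Fin W → ZMod p) :=
    LinearMap.pi fun l => LinearMap.pi fun w => (lcoeff (ZMod p) w.val) ∘ₗ (P l.val)
  have hfd : FiniteDimensional (ZMod p) (degreeLT (ZMod p) n) :=
    (degreeLTEquiv (ZMod p) n).symm.finiteDimensional
  have hfr : Module.finrank (ZMod p) (degreeLT (ZMod p) n) = n := by
    rw [(degreeLTEquiv (ZMod p) n).finrank_eq]; simp
  have hker : LinearMap.ker Λ ≠ ⊥ := by
    apply LinearMap.ker_ne_bot_of_finrank_lt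
    have e1 : Module.finrank (ZMod p) (Fin M → Fin W → ZMod p) = M * W := by
      rw [Module.finrank_pi_fintype]; simp
    have e2 : Module.finrank (ZMod p) V = D * K * n := by
      rw [Module.finrank_pi_fintype]; simp [hfr]
    rw [e1, e2]; exact hineq
  obtain ⟨v, hv, hv0⟩ := (Submodule.ne_bot_iff _).1 hker
  have hvd : ∀ t, ((v t : (ZMod p)[X])).degree < n := fun t => mem_degreeLT.1 (v t).2
  have hvnd : ∀ t, ((v t : (ZMod p)[X])).natDegree ≤ n := fun t =>
    natDegree_le_of_degree_le (hvd t).le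
  -- the polynomials P l v vanish
  have hPz : ∀ l < M, P l v = 0 := by
    intro l hl
    have hdeg : (P l v).natDegree < W := by
      rcases Nat.eq_zero_or_pos K with hK | hK
      · subst hK; simp at hineq
      refine lt_of_le_of_lt (b := n + (K - 1) + M * m) ?_ (by omega)
      rw [hP]
      refine natDegree_sum_le_of_forall_le _ _ ?_
      intro t _
      refine natDegree_mul_le.trans ?_
      have h1 := natDegree_C_mul_X_pow_le (a ^ (t.val % D)) (t.val / D)
      have h2 := stepRho_natDegree f (M + n * (t.val % D)) m hm (v t : (ZMod p)[X]) l
      have h3 : l * m ≤ M * m := Nat.mul_le_mul_right _ hl.le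
      have h4 : t.val / D < K := by
        exact Nat.div_lt_of_lt_mul t.2
      have h5 := hvnd t
      omega
    ext w
    rw [coeff_zero]
    by_cases hw : w < W
    · have := congrFun (congrFun (LinearMap.mem_ker.1 hv) ⟨l, hl⟩) ⟨w, hw⟩
      simpa [Λ] using this
    · exact coeff_eq_zero_of_natDegree_lt (by omega)
  let s : ℕ → (ZMod p)[X] := fun t => if ht : t < D * K then (v ⟨t, ht⟩ : (ZMod p)[X]) else 0
  have hs : ∀ t, (s t).degree < n := by
    intro t
    simp only [s]
    split_ifs with ht
    · exact hvd _
    · rw [degree_zero]; exact WithBot.bot_lt_coe _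
  let Q : (ZMod p)[X] := ∑ t ∈ Finset.range (D * K), f ^ (n * (t % D)) * s t
      * X ^ ((n * D + 1) * (t / D))
  have hQ : Q ≠ 0 := by
    intro hQ0
    have := step_nonvanish h hh D n (D * K) s hs hQ0
    apply hv0
    funext t
    have h2 := this t.val t.2
    simp only [s, t.2, dif_pos] at h2
    exact Subtype.ext h2
  have hf0 : f ≠ 0 := by
    rw [hf]; refine mul_ne_zero X_ne_zero ?_
    rintro rfl; simp at hh
  let Φ : (ZMod p)[X] := f ^ M * Q
  have hΦ : Φ ≠ 0 := mul_ne_zero (pow_ne_zero _ hf0) hQ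
  have hΦe : Φ = ∑ t : Fin (D * K), f ^ (M + n * (t.val % D)) * (v t : (ZMod p)[X])
      * X ^ (p * (t.val / D)) := by
    simp only [Φ, Q]
    rw [Finset.sum_range, Finset.mul_sum]
    refine Finset.sum_congr rfl fun t _ => ?_
    simp only [s, t.2, dif_pos, hDn, pow_add]
    ring
  have hdegΦ : Φ.natDegree ≤ M * m + p * m + p * K := by
    rw [hΦe]
    refine natDegree_sum_le_of_forall_le _ _ ?_
    intro t _
    refine natDegree_mul_le.trans ?_
    rw [natDegree_X_pow]
    have h1 : (f ^ (M + n * (t.val % D)) * (v t : (ZMod p)[X])).natDegree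
        ≤ (M + n * (t.val % D)) * m + n := by
      refine natDegree_mul_le.trans (add_le_add ?_ (hvnd t))
      exact natDegree_pow_le.trans (Nat.mul_le_mul_left _ hm)
    have h4 : t.val / D < K := by
      exact Nat.div_lt_of_lt_mul t.2
    have h5 : t.val % D < D := Nat.mod_lt _ hD
    have h6 : n * (t.val % D) ≤ p := by
      have : n * (t.val % D) ≤ n * D := Nat.mul_le_mul_left _ h5.le
      omega
    have h7 : p * (t.val / D) + p ≤ p * K := by
      rw [← Nat.mul_succ]; exact Nat.mul_le_mul_left _ h4
    have h8 : n ≤ p := by nlinarith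
    have h9 : n * (t.val % D) * m ≤ p * m := Nat.mul_le_mul_right _ h6
    rw [add_mul] at h1
    omega
  refine (sum_mult_le Φ S M ?_).trans hdegΦ
  intro x hx
  rcases Nat.eq_zero_or_pos M with hM0 | hM0
  · omega
  have : M - 1 < Φ.rootMultiplicity x := by
    apply lt_rootMultiplicity_of_isRoot_iterate_derivative_of_mem_nonZeroDivisors' hΦ
    · intro l hl
      have hl' : l < M := by omega
      rw [hΦe, IsRoot.def, iterate_derivative_sum, eval_finsetSum]
      have := congrArg (fun R => (f.eval x) ^ (M - l) * eval x R) (hPz l hl')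
      simp only [eval_zero, mul_zero] at this
      rw [← this, hP, eval_finsetSum, Finset.mul_sum]
      refine Finset.sum_congr rfl fun t _ => ?_
      rw [stepRho_deriv _ _ _ _ _ (by omega)]
      simp only [eval_mul, eval_pow, eval_C, eval_X]
      rw [pow_mul x p, ZMod.pow_card x, show M + n * (t.val % D) - l = (M - l) + n * (t.val % D) by omega,
        pow_add, pow_mul, hS x hx]
      ring
    · intro l hl hl0
      rw [mem_nonZeroDivisors_iff_ne_zero]
      rw [Ne, ZMod.natCast_eq_zero_iff]
      intro hd
      have := Nat.le_of_dvd (by omega) hd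
      omega
  omega


lemma exists_primRoot (p : ℕ) [Fact p.Prime] : ∃ g : ZMod p, IsPrimitiveRoot g (p - 1) := by
  obtain ⟨g, hg⟩ := IsCyclic.exists_ofOrder_eq_natCard (α := (ZMod p)ˣ)
  refine ⟨g, ?_⟩
  rw [IsPrimitiveRoot.coe_units_iff]
  have : p - 1 = orderOf g := by
    rw [hg, Nat.card_eq_fintype_card, ZMod.card_units]
  rw [this]
  exact IsPrimitiveRoot.orderOf g

lemma char_eq_one_of_pow {p : ℕ} [Fact p.Prime] {D n : ℕ} (hDn : n * D + 1 = p)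
    {χ : MulChar (ZMod p) ℂ} (hχ : χ ^ D = 1) {z : ZMod p} (hz : z ^ n = 1) : χ z = 1 := by
  have hp := (Fact.out : p.Prime)
  have hp2 := hp.two_le
  obtain ⟨g, hg⟩ := exists_primRoot p
  have hn : n ≠ 0 := by rintro rfl; omega
  have hD : D ≠ 0 := by rintro rfl; omega
  have hgD : IsPrimitiveRoot (g ^ D) n :=
    hg.pow (by omega) (by rw [mul_comm]; omega)
  have : NeZero n := ⟨hn⟩
  obtain ⟨i, -, hi⟩ := hgD.eq_pow_of_pow_eq_one hz
  have hg0 : IsUnit (g ^ i) := (hg.isUnit (by omega)).pow i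
  rw [← hi, ← pow_mul, mul_comm, pow_mul, map_pow, ← MulChar.pow_apply' _ hD, hχ,
    MulChar.one_apply hg0]

lemma card_pow_eq {p : ℕ} [Fact p.Prime] {D n : ℕ} (hDn : n * D + 1 = p) :
    (Finset.univ.filter fun z : ZMod p => z ^ n = 1).card = n := by
  have hp := (Fact.out : p.Prime)
  have hp2 := hp.two_le
  obtain ⟨g, hg⟩ := exists_primRoot p
  have hn : n ≠ 0 := by rintro rfl; omega
  have hgD : IsPrimitiveRoot (g ^ D) n :=
    hg.pow (by omega) (by rw [mul_comm]; omega)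
  refine Eq.trans ?_ hgD.card_nthRootsFinset
  congr 1
  ext z
  rw [Polynomial.mem_nthRootsFinset (Nat.pos_of_ne_zero hn)]
  simp

/-- Summing a character over a fibre of `c ↦ c ^ n`. -/
lemma sum_fibre {p : ℕ} [Fact p.Prime] {D n : ℕ} (hDn : n * D + 1 = p)
    {χ : MulChar (ZMod p) ℂ} (hχ : χ ^ D = 1) (y : ZMod p) :
    ∑ c ∈ Finset.univ.filter (fun c : ZMod p => c ^ n = y ^ n), χ c = n * χ y := by
  have hp := (Fact.out : p.Prime)
  have hp2 := hp.two_le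
  have hn : n ≠ 0 := by rintro rfl; omega
  by_cases hy : y = 0
  · subst hy
    rw [MulChar.map_zero, mul_zero]
    refine Finset.sum_eq_zero fun c hc => ?_
    simp only [Finset.mem_filter, Finset.mem_univ, true_and, zero_pow hn, pow_eq_zero_iff hn] at hc
    rw [hc, MulChar.map_zero]
  · have : ∑ c ∈ Finset.univ.filter (fun c : ZMod p => c ^ n = y ^ n), χ c
        = ∑ z ∈ Finset.univ.filter (fun z : ZMod p => z ^ n = 1), χ y := by
      symm
      refine Finset.sum_bij' (fun z _ => y * z) (fun c _ => c / y) ?_ ?_ ?_ ?_ ?_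
      · intro z hz
        simp only [Finset.mem_filter, Finset.mem_univ, true_and] at hz ⊢
        rw [mul_pow, hz, mul_one]
      · intro c hc
        simp only [Finset.mem_filter, Finset.mem_univ, true_and] at hc ⊢
        rw [div_pow, hc, div_self (pow_ne_zero _ hy)]
      · intro z _; field_simp
      · intro c _; field_simp
      · intro z hz
        simp only [Finset.mem_filter, Finset.mem_univ, true_and] at hz
        rw [map_mul, char_eq_one_of_pow hDn hχ hz, mul_one]
    rw [this, Finset.sum_const, card_pow_eq hDn, nsmul_eq_mul]

lemma card_fibre {p : ℕ} [Fact p.Prime] {D n : ℕ} (hDn : n * D + 1 = p)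
    (y : ZMod p) (hy : y ≠ 0) :
    (Finset.univ.filter (fun c : ZMod p => c ^ n = y ^ n)).card = n := by
  conv_rhs => rw [← card_pow_eq hDn]
  symm
  refine Finset.card_bij' (fun z _ => y * z) (fun c _ => c / y) ?_ ?_ ?_ ?_
  · intro z hz
    simp only [Finset.mem_filter, Finset.mem_univ, true_and] at hz ⊢
    rw [mul_pow, hz, mul_one]
  · intro c hc
    simp only [Finset.mem_filter, Finset.mem_univ, true_and] at hc ⊢
    rw [div_pow, hc, div_self (pow_ne_zero _ hy)]
  · intro z _; field_simp
  · intro c _; field_simp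

/-- From one-sided bounds for all fibres to a character sum bound. -/
lemma char_sum_of_fibres {p : ℕ} [Fact p.Prime] {D n : ℕ} (hDn : n * D + 1 = p)
    {χ : MulChar (ZMod p) ℂ} (hχ : χ ^ D = 1) (hχ1 : χ ≠ 1) (F : ZMod p → ZMod p) (m : ℕ)
    (hF : (Finset.univ.filter fun x => F x = 0).card ≤ m) (U : ℝ)
    (hU : ∀ a : ZMod p, ((Finset.univ.filter fun x => F x ^ n = a).card : ℝ) ≤ U) :
    ‖∑ x, χ (F x)‖ ≤ D * U - p + m := by
  classical
  have hp := (Fact.out : p.Prime)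
  have hp2 := hp.two_le
  have hn : n ≠ 0 := by rintro rfl; omega
  let T : ZMod p → ℝ := fun c => ((Finset.univ.filter fun x => F x ^ n = c ^ n).card : ℝ)
  have h1 : (n : ℂ) * ∑ x, χ (F x) = ∑ c, χ c * (T c : ℂ) := by
    have : ∀ c, χ c * (T c : ℂ) = ∑ x, if c ^ n = F x ^ n then χ c else 0 := by
      intro c
      rw [← Finset.sum_filter, Finset.sum_const, nsmul_eq_mul, mul_comm]
      simp [T, eq_comm]
    simp only [this]
    rw [Finset.sum_comm, Finset.mul_sum]
    refine Finset.sum_congr rfl fun x _ => ?_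
    rw [← Finset.sum_filter, sum_fibre hDn hχ]
  have h2 : (n : ℂ) * ∑ x, χ (F x) = - ∑ c ∈ Finset.univ.erase 0, χ c * ((U - T c : ℝ) : ℂ) := by
    rw [h1]
    have e1 : ∑ c, χ c * ((U - T c : ℝ) : ℂ) = - ∑ c, χ c * (T c : ℂ) := by
      have : ∑ c, χ c * (U : ℂ) = 0 := by
        rw [← Finset.sum_mul, MulChar.sum_eq_zero_of_ne_one hχ1, zero_mul]
      simp only [Complex.ofReal_sub, mul_sub, Finset.sum_sub_distrib, this, zero_sub]
    rw [← Finset.add_sum_erase _ _ (Finset.mem_univ (0 : ZMod p)), MulChar.map_zero,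
      zero_mul, zero_add] at e1
    rw [e1, neg_neg]
  have h3 : ∑ c ∈ Finset.univ.erase (0 : ZMod p), T c ≥ n * ((p : ℝ) - m) := by
    have e1 : ∀ c, T c = ∑ x, if c ^ n = F x ^ n then (1 : ℝ) else 0 := by
      intro c
      rw [← Finset.sum_filter, Finset.sum_const, nsmul_eq_mul]
      simp [T, eq_comm]
    simp only [e1]
    rw [Finset.sum_comm]
    have e2 : ∀ x, (if F x = 0 then (0 : ℝ) else n) ≤
        ∑ c ∈ Finset.univ.erase (0 : ZMod p), if c ^ n = F x ^ n then (1 : ℝ) else 0 := by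
      intro x
      split_ifs with hx
      · exact Finset.sum_nonneg fun c _ => by split_ifs <;> norm_num
      · have e3 := Finset.add_sum_erase Finset.univ
          (fun c : ZMod p => if c ^ n = F x ^ n then (1 : ℝ) else 0) (Finset.mem_univ 0)
        have e4 : ¬ ((0 : ZMod p) ^ n = F x ^ n) := by
          rw [zero_pow hn]; exact fun h => pow_ne_zero n hx h.symm
        simp only [e4, if_false, zero_add] at e3
        rw [e3, ← Finset.sum_filter, Finset.sum_const, nsmul_eq_mul, mul_one,
          card_fibre hDn _ hx]
    refine le_trans ?_ (Finset.sum_le_sum fun x _ => e2 x)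
    have e5 : ∀ x, (if F x = 0 then (0 : ℝ) else n) = n - n * (if F x = 0 then 1 else 0) := by
      intro x; split_ifs <;> simp
    simp only [e5]
    rw [Finset.sum_sub_distrib, ← Finset.mul_sum, ← Finset.sum_filter, Finset.sum_const,
      Finset.sum_const, Finset.card_univ, ZMod.card]
    simp only [nsmul_eq_mul, mul_one]
    have : ((Finset.univ.filter fun x => F x = 0).card : ℝ) ≤ m := by exact_mod_cast hF
    have hn0 : (0 : ℝ) ≤ n := by positivity
    nlinarith
  have h4 : (n : ℝ) * ‖∑ x, χ (F x)‖ ≤ (p - 1) * U - n * (p - m) := by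
    calc (n : ℝ) * ‖∑ x, χ (F x)‖ = ‖(n : ℂ) * ∑ x, χ (F x)‖ := by simp
      _ ≤ ∑ c ∈ Finset.univ.erase (0 : ZMod p), (U - T c) := by
        rw [h2, norm_neg]
        refine (norm_sum_le _ _).trans (Finset.sum_le_sum fun c _ => ?_)
        have hTU : 0 ≤ U - T c := sub_nonneg.2 (hU _)
        rw [norm_mul, Complex.norm_real, Real.norm_of_nonneg hTU]
        have := DirichletCharacter.norm_le_one χ c
        nlinarith
      _ ≤ _ := by
        rw [Finset.sum_sub_distrib, Finset.sum_const, Finset.card_erase_of_mem (Finset.mem_univ _),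
          Finset.card_univ, ZMod.card, nsmul_eq_mul, Nat.cast_sub (by omega), Nat.cast_one]
        linarith
  have hp' : (p : ℝ) - 1 = n * D := by
    have : (p : ℝ) = n * D + 1 := by exact_mod_cast hDn.symm
    linarith
  have hn0 : (0 : ℝ) < n := by positivity
  rw [hp'] at h4
  refine le_of_mul_le_mul_left (h4.trans (le_of_eq (by ring))) hn0

lemma weil_arith {D m c s t : ℝ} (hD : 1 ≤ D) (hm : 1 ≤ m) (hs : 1 ≤ s)
    (hc : c = 2 * D + 2 * D ^ 2 * m + 1) (ht : t ≤ 4 * s) (ht0 : 0 ≤ t) :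
    D * m + m + (m + c) * t ≤ 32 * D ^ 2 * m * s := by
  have hD2 : D ≤ D ^ 2 := by nlinarith
  have h1 : D * m ≤ D ^ 2 * m := mul_le_mul_of_nonneg_right hD2 (by linarith)
  have h2 : D ≤ D * m := by nlinarith
  have h3 : m ≤ D * m := by nlinarith
  have h4 : m + c ≤ 6 * (D ^ 2 * m) := by rw [hc]; linarith
  have h5 : (m + c) * t ≤ 6 * (D ^ 2 * m) * (4 * s) :=
    mul_le_mul h4 ht ht0 (by positivity)
  have h6 : D ^ 2 * m ≤ D ^ 2 * m * s := by
    have : 0 ≤ D ^ 2 * m := by positivity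
    nlinarith
  nlinarith

open Polynomial in
lemma weil_zero {p : ℕ} [Fact p.Prime] {D n : ℕ} (hDn : n * D + 1 = p)
    (hDp : (2 * D + 1) ^ 2 ≤ p) {χ : MulChar (ZMod p) ℂ} (hχ : χ ^ D = 1) (hχ1 : χ ≠ 1)
    (h : (ZMod p)[X]) (hh : h.eval 0 ≠ 0) (m : ℕ) (hm : (X * h).natDegree ≤ m) :
    ‖∑ x, χ ((X * h).eval x)‖ ≤ 32 * D ^ 2 * m * Real.sqrt p := by
  have hp := (Fact.out : p.Prime)
  have hp2 := hp.two_le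
  have hD : 0 < D := by rcases Nat.eq_zero_or_pos D with h | h; · subst h; omega
                        · exact h
  have hh0 : h ≠ 0 := by rintro rfl; simp at hh
  have hf0 : X * h ≠ 0 := mul_ne_zero X_ne_zero hh0
  have hm1 : 1 ≤ m := by
    rw [natDegree_mul X_ne_zero hh0, natDegree_X] at hm; omega
  set L := Nat.sqrt (p - 1) with hL
  have hL1 : L * L ≤ p - 1 := Nat.sqrt_le _
  have hL2 : p ≤ (L + 1) * (L + 1) := by
    have := Nat.lt_succ_sqrt (p - 1)
    simp only [Nat.succ_eq_add_one, ← hL] at this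
    omega
  have hLD : 2 * D ≤ L := by
    rw [hL, Nat.le_sqrt]
    have : 2 * D * (2 * D) + 1 ≤ (2 * D + 1) ^ 2 := by nlinarith
    omega
  set c := 2 * D + 2 * D ^ 2 * m + 1 with hc
  have hkey : (D * L) * (n + (L + c) + (D * L) * m) < D * (L + c) * n := by
    have h1 : L * L ≤ n * D := by omega
    have h2 : 2 * (D * L * c) ≤ L * L * c := by
      have : 2 * D * (L * c) ≤ L * (L * c) := Nat.mul_le_mul_right _ hLD
      nlinarith
    have hLpos : 0 < L := by omega
    have h3 : D * L * (L + c + D * L * m) < c * (L * L) := by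
      have : 0 < L * L := Nat.mul_pos hLpos hLpos
      have h4 : c * (L * L) = L * L * (2 * D + 2 * D ^ 2 * m) + L * L := by rw [hc]; ring
      have h5 : D * L * (L + c + D * L * m) = (L * L) * (D + D ^ 2 * m) + D * L * c := by ring
      have h6 : L * L * c = c * (L * L) := by ring
      rw [h5]
      nlinarith
    have h7 : c * (L * L) ≤ c * (n * D) := Nat.mul_le_mul_left _ h1
    nlinarith
  have hMp : D * L ≤ p := by
    have : D * L ≤ L * L := Nat.mul_le_mul_right _ (by omega)
    omega
  have hLpos : (0 : ℝ) < L := by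
    have : 0 < L := by omega
    exact_mod_cast this
  have hDpos : (0 : ℝ) < D := by exact_mod_cast hD
  have hm1' : (1 : ℝ) ≤ m := by exact_mod_cast hm1
  have hD1' : (1 : ℝ) ≤ D := by exact_mod_cast hD
  have hU : ∀ a : ZMod p, ((Finset.univ.filter fun x => ((X * h).eval x) ^ n = a).card : ℝ)
      ≤ m + p * (m + L + c) / (D * L) := by
    intro a
    have := stepanov_raw h hh D n m (D * L) (L + c) hD hDn hm hMp hkey a
      (Finset.univ.filter fun x => ((X * h).eval x) ^ n = a) (by simp)
    have h2 : ((Finset.univ.filter fun x => ((X * h).eval x) ^ n = a).card : ℝ) * (D * L)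
        ≤ D * L * m + p * m + p * (L + c) := by exact_mod_cast this
    rw [← sub_le_iff_le_add', le_div_iff₀ (by positivity)]
    linarith
  have hF : (Finset.univ.filter fun x => (X * h).eval x = 0).card ≤ m := by
    classical
    refine le_trans ?_ ((card_roots' (X * h)).trans hm)
    refine le_trans (Finset.card_le_card (t := (X * h).roots.toFinset) ?_)
      (Multiset.toFinset_card_le _)
    intro x hx
    simp only [Finset.mem_filter, Finset.mem_univ, true_and] at hx
    rw [Multiset.mem_toFinset, mem_roots hf0]
    exact hx
  refine (char_sum_of_fibres hDn hχ hχ1 _ m hF _ hU).trans ?_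
  have e1 : (D : ℝ) * (m + p * (m + L + c) / (D * L)) - p + m = D * m + m + (m + c) * (p / L) := by
    field_simp
    ring
  rw [e1]
  have hLs : (L : ℝ) ≤ Real.sqrt p := by
    apply Real.le_sqrt_of_sq_le
    have : L * L ≤ p := by omega
    rw [sq]; exact_mod_cast this
  have hpL : (p : ℝ) / L ≤ 4 * Real.sqrt p := by
    rw [div_le_iff₀ hLpos]
    have h1 : (p : ℝ) ≤ (L + 1) * (L + 1) := by exact_mod_cast hL2
    have h2 : (1 : ℝ) ≤ L := by
      have : 1 ≤ L := by omega
      exact_mod_cast this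
    nlinarith
  have hs1 : (1 : ℝ) ≤ Real.sqrt p := by
    rw [Real.one_le_sqrt]; exact_mod_cast hp2.trans' (by norm_num)
  have hcR : (c : ℝ) = 2 * D + 2 * D ^ 2 * m + 1 := by rw [hc]; push_cast; ring
  exact weil_arith hD1' hm1' hs1 hcR hpL (by positivity)

open Polynomial in
/-- Weil-type bound via Stepanov, for polynomials with a simple root. -/
lemma weil_bound {p : ℕ} [Fact p.Prime] {D n : ℕ} (hDn : n * D + 1 = p)
    (hDp : (2 * D + 1) ^ 2 ≤ p) {χ : MulChar (ZMod p) ℂ} (hχ : χ ^ D = 1) (hχ1 : χ ≠ 1)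
    (b : ZMod p) (h : (ZMod p)[X]) (hh : h.eval b ≠ 0) (m : ℕ)
    (hm : ((X - C b) * h).natDegree ≤ m) :
    ‖∑ x, χ (((X - C b) * h).eval x)‖ ≤ 32 * D ^ 2 * m * Real.sqrt p := by
  have e : ((X - C b) * h).comp (X + C b) = X * h.comp (X + C b) := by simp
  have := weil_zero hDn hDp hχ hχ1 (h.comp (X + C b)) (by simpa using hh) m (by
    rw [← e, natDegree_comp, natDegree_X_add_C, mul_one]; exact hm)
  refine le_trans (le_of_eq ?_) this
  congr 1
  rw [← e]
  refine Fintype.sum_equiv (Equiv.subRight b) _ _ ?_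
  intro x
  simp


open ComplexConjugate in
lemma conj_char {p : ℕ} [Fact p.Prime] {D : ℕ} (hD : 2 ≤ D)
    {χ : MulChar (ZMod p) ℂ} (hχ : χ ^ D = 1) (y : ZMod p) :
    conj (χ y) = χ (y ^ (D - 1)) := by
  by_cases hy : y = 0
  · subst hy
    rw [zero_pow (by omega), MulChar.map_zero, map_zero]
  · have hu : IsUnit y := IsUnit.mk0 y hy
    have h1 : χ y * χ (y ^ (D - 1)) = 1 := by
      rw [← map_mul, ← pow_succ', Nat.sub_add_cancel (by omega), map_pow,
        ← MulChar.pow_apply' _ (by omega), hχ, MulChar.one_apply hu]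
    have h2 : χ y * conj (χ y) = 1 := by
      have h3 : ‖χ y‖ = 1 := DirichletCharacter.unit_norm_eq_one χ hu.unit
      rw [Complex.mul_conj, Complex.normSq_eq_norm_sq, h3]; simp
    have h4 : χ y ≠ 0 := fun h => by simp [h] at h1
    exact mul_left_cancel₀ h4 (h2.trans h1.symm)

open Polynomial ComplexConjugate in
lemma good_pair {p : ℕ} [Fact p.Prime] {D n : ℕ} (hDn : n * D + 1 = p)
    (hDp : (2 * D + 1) ^ 2 ≤ p) {χ : MulChar (ZMod p) ℂ} (hχ : χ ^ D = 1) (hχ1 : χ ≠ 1)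
    {r : ℕ} (β γ : Fin r → ZMod p) (i₀ : Fin r) (h1 : ∀ i, i ≠ i₀ → β i ≠ β i₀)
    (h2 : ∀ i, γ i ≠ β i₀) :
    ‖∑ x, (∏ i, χ (x + β i)) * ∏ i, conj (χ (x + γ i))‖ ≤ 32 * D ^ 3 * r * Real.sqrt p := by
  classical
  have hD : 2 ≤ D := by
    by_contra hlt
    have : D = 0 ∨ D = 1 := by omega
    rcases this with rfl | rfl
    · have := (Fact.out : p.Prime).two_le
      omega
    · rw [pow_one] at hχ; exact hχ1 hχ
  set h : (ZMod p)[X] := (∏ i ∈ Finset.univ.erase i₀, (X + C (β i))) *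
    ∏ i, (X + C (γ i)) ^ (D - 1) with hh
  have hev : h.eval (-β i₀) ≠ 0 := by
    rw [hh, eval_mul, eval_prod, eval_prod]
    refine mul_ne_zero (Finset.prod_ne_zero_iff.2 fun i hi => ?_)
      (Finset.prod_ne_zero_iff.2 fun i _ => ?_)
    · have := h1 i (Finset.ne_of_mem_erase hi)
      simp only [eval_add, eval_X, eval_C]
      intro h0
      exact this (by linear_combination h0)
    · simp only [eval_pow, eval_add, eval_X, eval_C]
      refine pow_ne_zero _ fun h0 => h2 i (by linear_combination h0)
  have hdeg : ((X - C (-β i₀)) * h).natDegree ≤ r * D := by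
    have e : (X - C (-β i₀)) * h = (∏ i, (X + C (β i))) * ∏ i, (X + C (γ i)) ^ (D - 1) := by
      rw [hh, ← mul_assoc, ← Finset.mul_prod_erase Finset.univ (fun i => X + C (β i))
        (Finset.mem_univ i₀), C_neg, sub_neg_eq_add]
    rw [e]
    refine natDegree_mul_le.trans ?_
    have e1 : (∏ i, (X + C (β i))).natDegree ≤ r := by
      refine (natDegree_prod_le _ _).trans ?_
      simp
    have e2 : (∏ i, (X + C (γ i)) ^ (D - 1)).natDegree ≤ r * (D - 1) := by
      refine (natDegree_prod_le _ _).trans ?_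
      simp
    have e3 : r * D = r + r * (D - 1) := by
      obtain ⟨k, rfl⟩ : ∃ k, D = k + 1 := ⟨D - 1, by omega⟩
      simp only [Nat.add_sub_cancel]; ring
    omega
  have := weil_bound hDn hDp hχ hχ1 (-β i₀) h hev (r * D) hdeg
  refine le_trans (le_of_eq ?_) (this.trans (le_of_eq (by push_cast; ring)))
  congr 1
  refine Finset.sum_congr rfl fun x _ => ?_
  simp only [conj_char hD hχ]
  rw [← map_prod, ← map_prod, ← map_mul]
  congr 1
  rw [hh, ← Finset.mul_prod_erase Finset.univ _ (Finset.mem_univ i₀)]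
  simp only [eval_mul, eval_prod, eval_add, eval_X, eval_C, eval_pow, eval_sub]
  ring

lemma bad_count (r B : ℕ) (hr : 0 < r) :
    (Finset.univ.filter fun δ : Fin r ⊕ Fin r → Fin B =>
      ∀ k, ∃ k', k' ≠ k ∧ δ k' = δ k).card ≤ r ^ (2 * r) * B ^ r := by
  classical
  have hcard : Fintype.card ((Fin r ⊕ Fin r → Fin r) × (Fin r → Fin B)) = r ^ (2 * r) * B ^ r := by
    simp [two_mul]
  rw [← hcard, ← Finset.card_univ]
  refine Finset.card_le_card_of_surjOn (fun q => q.2 ∘ q.1) ?_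
  intro δ hδ
  simp only [Finset.coe_filter, Finset.mem_univ, true_and, Set.mem_ofPred_eq] at hδ
  let s := Finset.univ.image δ
  have hs : s.card ≤ r := by
    have h1 : 2 * s.card ≤ (Finset.univ : Finset (Fin r ⊕ Fin r)).card := by
      refine Finset.mul_card_image_le_card _ _ ?_
      intro b hb
      obtain ⟨k, -, rfl⟩ := Finset.mem_image.1 hb
      obtain ⟨k', hk', he⟩ := hδ k
      rw [Nat.succ_le_iff, Finset.one_lt_card]
      exact ⟨k, by simp, k', by simp [he], hk'.symm⟩
    simp only [Finset.card_univ, Fintype.card_sum, Fintype.card_fin] at h1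
    omega
  have hne : Nonempty (Fin r ⊕ Fin r) := ⟨Sum.inl ⟨0, hr⟩⟩
  have hne' : Nonempty s := ⟨⟨δ hne.some, Finset.mem_image_of_mem _ (Finset.mem_univ _)⟩⟩
  obtain ⟨e⟩ : Nonempty (s ↪ Fin r) :=
    Function.Embedding.nonempty_of_card_le (by simpa using hs)
  refine ⟨(fun k => e ⟨δ k, Finset.mem_image_of_mem _ (Finset.mem_univ _)⟩,
    fun i => (Function.invFun e i).val), by simp, ?_⟩
  funext k
  simp [Function.leftInverse_invFun e.injective _]

open ComplexConjugate in
lemma moment_bound {p : ℕ} [Fact p.Prime] {D n : ℕ} (hDn : n * D + 1 = p)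
    (hDp : (2 * D + 1) ^ 2 ≤ p) {χ : MulChar (ZMod p) ℂ} (hχ : χ ^ D = 1) (hχ1 : χ ≠ 1)
    (r B : ℕ) (hr : 0 < r) (hB : B ≤ p) :
    ∑ x : ZMod p, ‖∑ b ∈ Finset.range B, χ (x + b)‖ ^ (2 * r) ≤
      r ^ (2 * r) * B ^ r * p + B ^ (2 * r) * (32 * D ^ 3 * r * Real.sqrt p) := by
  classical
  let ι : Fin B → ZMod p := fun b => ((b : ℕ) : ZMod p)
  have hι : Function.Injective ι := by
    intro a b hab
    have := (ZMod.natCast_eq_natCast_iff' _ _ _).1 hab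
    rw [Nat.mod_eq_of_lt (by omega), Nat.mod_eq_of_lt (by omega)] at this
    exact Fin.ext this
  let G : (Fin r ⊕ Fin r → Fin B) → ℂ := fun δ =>
    ∑ x : ZMod p, (∏ i, χ (x + ι (δ (Sum.inl i)))) * ∏ i, conj (χ (x + ι (δ (Sum.inr i))))
  have hG : ((∑ x : ZMod p, ‖∑ b ∈ Finset.range B, χ (x + b)‖ ^ (2 * r) : ℝ) : ℂ) = ∑ δ, G δ := by
    simp only [G]
    rw [Finset.sum_comm, Complex.ofReal_sum]
    refine Finset.sum_congr rfl fun x _ => ?_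
    rw [Finset.sum_range, Complex.ofReal_pow, pow_mul, ← Complex.conj_mul', mul_comm, mul_pow,
      map_sum, Fintype.sum_pow, Fintype.sum_pow, Finset.sum_mul_sum, ← Finset.sum_product',
      Finset.univ_product_univ]
    exact (Fintype.sum_equiv (Equiv.sumArrowEquivProdArrow (Fin r) (Fin r) (Fin B)) _ _
      (fun δ => rfl)).symm
  have hGtriv : ∀ δ, ‖G δ‖ ≤ p := by
    intro δ
    refine (norm_sum_le _ _).trans ?_
    refine (Finset.sum_le_card_nsmul _ _ 1 ?_).trans (by simp)
    intro x _
    rw [norm_mul, norm_prod, norm_prod]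
    refine mul_le_one₀ ?_ ?_ ?_
    · exact Finset.prod_le_one (fun _ _ => norm_nonneg _)
        fun i _ => DirichletCharacter.norm_le_one χ _
    · exact Finset.prod_nonneg (fun _ _ => norm_nonneg _)
    · exact Finset.prod_le_one (fun _ _ => norm_nonneg _)
        fun i _ => by rw [RCLike.norm_conj]; exact DirichletCharacter.norm_le_one χ _
  have hGgood : ∀ δ, (¬ ∀ k, ∃ k', k' ≠ k ∧ δ k' = δ k) →
      ‖G δ‖ ≤ 32 * D ^ 3 * r * Real.sqrt p := by
    intro δ hδ
    push Not at hδ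
    obtain ⟨k, hk⟩ := hδ
    rcases k with i | i
    · refine good_pair hDn hDp hχ hχ1 (fun i => ι (δ (Sum.inl i)))
        (fun i => ι (δ (Sum.inr i))) i ?_ ?_
      · intro j hj
        exact fun h => hk (Sum.inl j) (by simpa using hj) (hι h)
      · intro j
        exact fun h => hk (Sum.inr j) (by simp) (hι h)
    · have := good_pair hDn hDp hχ hχ1 (fun i => ι (δ (Sum.inr i)))
        (fun i => ι (δ (Sum.inl i))) i ?_ ?_
      · refine le_trans (le_of_eq ?_) this
        rw [← RCLike.norm_conj]
        congr 1
        simp only [G, map_sum, map_mul, map_prod, Complex.conj_conj]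
        refine Finset.sum_congr rfl fun x _ => mul_comm _ _
      · intro j hj
        exact fun h => hk (Sum.inr j) (by simpa using hj) (hι h)
      · intro j
        exact fun h => hk (Sum.inl j) (by simp) (hι h)
  have h0 : (0 : ℝ) ≤ ∑ x : ZMod p, ‖∑ b ∈ Finset.range B, χ (x + b)‖ ^ (2 * r) := by positivity
  rw [← Real.norm_of_nonneg h0, ← Complex.norm_real, hG]
  refine (norm_sum_le _ _).trans ?_
  rw [← Finset.sum_filter_add_sum_filter_not Finset.univ
    (fun δ : Fin r ⊕ Fin r → Fin B => ∀ k, ∃ k', k' ≠ k ∧ δ k' = δ k)]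
  refine add_le_add ?_ ?_
  · refine (Finset.sum_le_card_nsmul _ _ (p : ℝ) (fun δ _ => hGtriv δ)).trans ?_
    rw [nsmul_eq_mul]
    refine mul_le_mul_of_nonneg_right ?_ (by positivity)
    exact_mod_cast bad_count r B hr
  · refine (Finset.sum_le_card_nsmul _ _ _ (fun δ hδ => hGgood δ (Finset.mem_filter.1 hδ).2)).trans ?_
    rw [nsmul_eq_mul]
    refine mul_le_mul_of_nonneg_right ?_ (by positivity)
    have : (Finset.univ.filter fun δ : Fin r ⊕ Fin r → Fin B =>
      ¬ ∀ k, ∃ k', k' ≠ k ∧ δ k' = δ k).card ≤ B ^ (2 * r) := by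
      refine (Finset.card_le_univ _).trans ?_
      simp [two_mul]
    exact_mod_cast this


/-- The divisor bound. -/
lemma divisor_bound (κ : ℝ) (hκ : 0 < κ) : ∃ C : ℝ, 1 ≤ C ∧ ∀ n : ℕ, n ≠ 0 →
    (n.divisors.card : ℝ) ≤ C * (n : ℝ) ^ κ := by
  obtain ⟨X0, hX0⟩ := exists_nat_ge ((2 : ℝ) ^ (1 / κ))
  set c : ℝ := min 1 (κ * Real.log 2) with hc
  have hl2 : 0 < Real.log 2 := Real.log_pos (by norm_num)
  have hc0 : 0 < c := lt_min one_pos (by positivity)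
  have hc1 : c ≤ 1 := min_le_left _ _
  have hC0 : 1 ≤ 1 / c := by rw [le_div_iff₀ hc0]; linarith
  refine ⟨(1 / c) ^ X0, one_le_pow₀ hC0, ?_⟩
  intro n hn
  have hterm : ∀ x ∈ n.primeFactors, ((n.factorization x + 1 : ℕ) : ℝ) ≤
      (if x < X0 then 1 / c else 1) * ((x : ℝ) ^ κ) ^ (n.factorization x) := by
    intro x hx
    have hx2 : 2 ≤ x := (Nat.prime_of_mem_primeFactors hx).two_le
    have hx2' : (2 : ℝ) ≤ x := by exact_mod_cast hx2
    set a := n.factorization x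
    split_ifs with hlt
    · have h1 : 1 + κ * Real.log 2 * a ≤ ((x : ℝ) ^ κ) ^ a := by
        have h2 : ((2 : ℝ) ^ κ) ^ a ≤ ((x : ℝ) ^ κ) ^ a := by
          gcongr
        refine le_trans ?_ h2
        have h3 : ((2 : ℝ) ^ κ) ^ a = Real.exp (κ * Real.log 2 * a) := by
          rw [Real.rpow_def_of_pos (by norm_num), ← Real.exp_nat_mul]
          congr 1; ring
        rw [h3]
        linarith [Real.add_one_le_exp (κ * Real.log 2 * a)]
      have h4 : c * (a + 1) ≤ 1 + κ * Real.log 2 * a := by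
        have : c ≤ κ * Real.log 2 := min_le_right _ _
        have ha : (0 : ℝ) ≤ a := by positivity
        nlinarith
      rw [div_mul_eq_mul_div, one_mul, le_div_iff₀ hc0]
      push_cast
      linarith
    · rw [one_mul]
      have h1 : (2 : ℝ) ≤ (x : ℝ) ^ κ := by
        have h2 : (2 : ℝ) ^ (1 / κ) ≤ x := hX0.trans (by exact_mod_cast not_lt.1 hlt)
        calc (2 : ℝ) = ((2 : ℝ) ^ (1 / κ)) ^ κ := by
              rw [← Real.rpow_mul (by norm_num)]; field_simp; simp
          _ ≤ _ := by gcongr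
      calc ((a + 1 : ℕ) : ℝ) ≤ 2 ^ a := by exact_mod_cast Nat.succ_le_of_lt Nat.lt_two_pow_self
        _ ≤ _ := by gcongr
  rw [Nat.card_divisors hn, Nat.cast_prod]
  refine (Finset.prod_le_prod (fun _ _ => by positivity) hterm).trans ?_
  rw [Finset.prod_mul_distrib]
  have e1 : ∏ x ∈ n.primeFactors, ((x : ℝ) ^ κ) ^ (n.factorization x) = (n : ℝ) ^ κ := by
    conv_rhs => rw [← Nat.prod_factorization_pow_eq_self hn]
    rw [Finsupp.prod, Nat.cast_prod, Nat.support_factorization,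
      ← Real.finsetProd_rpow _ _ (fun _ _ => by positivity)]
    refine Finset.prod_congr rfl fun x _ => ?_
    rw [Nat.cast_pow, ← Real.rpow_natCast, ← Real.rpow_natCast, ← Real.rpow_mul (by positivity),
      ← Real.rpow_mul (by positivity), mul_comm]
  rw [e1]
  refine mul_le_mul_of_nonneg_right ?_ (by positivity)
  rw [Finset.prod_ite, Finset.prod_const_one, mul_one, Finset.prod_const]
  refine pow_le_pow_right₀ hC0 ?_
  have : (n.primeFactors.filter fun x => x < X0) ⊆ Finset.range X0 := by
    intro x hx
    exact Finset.mem_range.2 (Finset.mem_filter.1 hx).2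
  simpa using Finset.card_le_card this

lemma shift_bound (f : ℕ → ℂ) (hf : ∀ n, ‖f n‖ ≤ 1) (H k : ℕ) :
    ‖∑ n ∈ Finset.Icc 1 H, f n - ∑ n ∈ Finset.Icc 1 H, f (n + k)‖ ≤ 2 * k := by
  induction k with
  | zero => simp
  | succ k ih =>
    have h1 : ∑ n ∈ Finset.Icc 1 H, f (n + k) - ∑ n ∈ Finset.Icc 1 H, f (n + (k + 1))
        = f (1 + k) - f (H + 1 + k) := by
      have e : Finset.Icc 1 H = Finset.Ico 1 (H + 1) := by ext; simp [Nat.lt_succ_iff]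
      rw [e, ← Finset.sum_sub_distrib, Finset.sum_Ico_eq_sum_range, Nat.add_sub_cancel]
      have := Finset.sum_range_sub' (fun i => f (1 + i + k)) H
      rw [show H + 1 + k = 1 + H + k by ring]
      simpa [add_assoc, add_comm, add_left_comm] using this
    have h2 : ‖f (1 + k) - f (H + 1 + k)‖ ≤ 2 := by
      refine (norm_sub_le _ _).trans ?_
      linarith [hf (1 + k), hf (H + 1 + k)]
    have h3 : ∑ n ∈ Finset.Icc 1 H, f n - ∑ n ∈ Finset.Icc 1 H, f (n + (k + 1)) =
      (∑ n ∈ Finset.Icc 1 H, f n - ∑ n ∈ Finset.Icc 1 H, f (n + k)) +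
      (f (1 + k) - f (H + 1 + k)) := by rw [← h1]; ring
    rw [h3]
    refine (norm_add_le _ _).trans ?_
    push_cast
    linarith

lemma burgess_shift {p : ℕ} [Fact p.Prime] (χ : MulChar (ZMod p) ℂ) (H A B : ℕ) (hA : A < p) :
    (A : ℝ) * B * ‖∑ n ∈ Finset.Icc 1 H, χ (n : ZMod p)‖ ≤
      ∑ q ∈ Finset.Icc 1 A ×ˢ Finset.Icc 1 H,
        ‖∑ b ∈ Finset.range B, χ ((q.2 : ZMod p) * (q.1 : ZMod p)⁻¹ + b)‖ + 2 * (A * B) ^ 2 := by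
  set S := ∑ n ∈ Finset.Icc 1 H, χ (n : ZMod p) with hS
  let S' : ℕ → ℕ → ℂ := fun a b => ∑ n ∈ Finset.Icc 1 H, χ ((n + a * b : ℕ) : ZMod p)
  have h1 : ∀ a ∈ Finset.Icc 1 A, ∀ b ∈ Finset.range B, ‖S - S' a b‖ ≤ 2 * (A * B) := by
    intro a ha b hb
    refine (shift_bound (fun n => χ (n : ZMod p))
      (fun n => DirichletCharacter.norm_le_one χ _) H (a * b)).trans ?_
    push_cast
    have ha' : (a : ℝ) ≤ A := by exact_mod_cast (Finset.mem_Icc.1 ha).2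
    have hb' : (b : ℝ) ≤ B := by exact_mod_cast (Finset.mem_range.1 hb).le
    gcongr
  have h2 : (A : ℂ) * B * S = ∑ a ∈ Finset.Icc 1 A, ∑ b ∈ Finset.range B, S' a b +
      ∑ a ∈ Finset.Icc 1 A, ∑ b ∈ Finset.range B, (S - S' a b) := by
    simp only [Finset.sum_sub_distrib, Finset.sum_const, Finset.card_range, Nat.card_Icc,
      Nat.add_sub_cancel, nsmul_eq_mul]
    ring
  have h3 : (A : ℝ) * B * ‖S‖ = ‖(A : ℂ) * B * S‖ := by simp
  rw [h3, h2]
  refine (norm_add_le _ _).trans (add_le_add ?_ ?_)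
  · rw [Finset.sum_product]
    refine (norm_sum_le _ _).trans (Finset.sum_le_sum fun a ha => ?_)
    have ha0 : (a : ZMod p) ≠ 0 := by
      rw [Ne, ZMod.natCast_eq_zero_iff]
      intro hd
      have := Finset.mem_Icc.1 ha
      have := Nat.le_of_dvd (by omega) hd
      omega
    have e1 : ∑ b ∈ Finset.range B, S' a b = χ a * ∑ n ∈ Finset.Icc 1 H,
        ∑ b ∈ Finset.range B, χ ((n : ZMod p) * (a : ZMod p)⁻¹ + b) := by
      simp only [S']
      rw [Finset.sum_comm, Finset.mul_sum]
      refine Finset.sum_congr rfl fun n _ => ?_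
      rw [Finset.mul_sum]
      refine Finset.sum_congr rfl fun b _ => ?_
      rw [← map_mul]
      congr 1
      push_cast
      field_simp
    rw [e1, norm_mul]
    calc _ ≤ 1 * ‖∑ n ∈ Finset.Icc 1 H,
          ∑ b ∈ Finset.range B, χ ((n : ZMod p) * (a : ZMod p)⁻¹ + b)‖ :=
          mul_le_mul_of_nonneg_right (DirichletCharacter.norm_le_one χ _) (norm_nonneg _)
      _ ≤ _ := by rw [one_mul]; exact norm_sum_le _ _
  · refine (norm_sum_le _ _).trans ?_
    refine (Finset.sum_le_card_nsmul _ _ (B * (2 * (A * B)) : ℝ) fun a ha => ?_).trans ?_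
    · refine (norm_sum_le _ _).trans ?_
      refine (Finset.sum_le_card_nsmul _ _ (2 * (A * B) : ℝ) fun b hb => h1 a ha b hb).trans ?_
      simp
    · simp only [Nat.card_Icc, Nat.add_sub_cancel, nsmul_eq_mul]
      apply le_of_eq; ring

/-- Number of coincidences among the fractions `n / a`. -/
lemma energy_bound {p : ℕ} [Fact p.Prime] (H A : ℕ) (hHA : H * A < p) (T : ℝ)
    (hT : ∀ k : ℕ, k ≠ 0 → k < p → (k.divisors.card : ℝ) ≤ T) :
    ∑ x : ZMod p, ((((Finset.Icc 1 A ×ˢ Finset.Icc 1 H).filter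
      fun q : ℕ × ℕ => (q.2 : ZMod p) * (q.1 : ZMod p)⁻¹ = x).card : ℝ)) ^ 2 ≤ H * A * T := by
  classical
  set Z := Finset.Icc 1 A ×ˢ Finset.Icc 1 H with hZ
  let φ : ℕ × ℕ → ZMod p := fun q => (q.2 : ZMod p) * (q.1 : ZMod p)⁻¹
  have hmem : ∀ q ∈ Z, (1 ≤ q.1 ∧ q.1 ≤ A) ∧ (1 ≤ q.2 ∧ q.2 ≤ H) := by
    intro q hq
    simpa [hZ, Finset.mem_product, Finset.mem_Icc] using hq
  have h1 : ∑ x : ZMod p, (((Z.filter fun q => φ q = x).card : ℕ)) ^ 2 =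
      ((Z ×ˢ Z).filter fun w => φ w.1 = φ w.2).card := by
    rw [Finset.card_eq_sum_card_fiberwise (f := fun w : (ℕ × ℕ) × (ℕ × ℕ) => φ w.1)
      (t := Finset.univ) (by intro x _; simp)]
    refine Finset.sum_congr rfl fun x _ => ?_
    rw [sq, ← Finset.card_product]
    congr 1
    ext w
    simp only [Finset.mem_product, Finset.mem_filter]
    constructor
    · rintro ⟨⟨h1, h2⟩, h3, h4⟩; exact ⟨⟨⟨h1, h3⟩, h2.trans h4.symm⟩, h2⟩
    · rintro ⟨⟨⟨h1, h3⟩, h2⟩, h4⟩; exact ⟨⟨h1, h4⟩, h3, h2.symm.trans h4⟩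
  have hne : ∀ a : ℕ, 1 ≤ a → a ≤ A → 1 ≤ H → (a : ZMod p) ≠ 0 := by
    intro a h1 h2 h3
    rw [Ne, ZMod.natCast_eq_zero_iff]
    intro hd
    have := Nat.le_of_dvd (by omega) hd
    nlinarith
  have hcross : ∀ q ∈ Z, ∀ q' ∈ Z, φ q = φ q' → q.2 * q'.1 = q'.2 * q.1 := by
    intro q hq q' hq' he
    obtain ⟨⟨a1, a2⟩, n1, n2⟩ := hmem q hq
    obtain ⟨⟨a1', a2'⟩, n1', n2'⟩ := hmem q' hq'
    have u1 := hne q.1 a1 a2 (by omega)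
    have u2 := hne q'.1 a1' a2' (by omega)
    simp only [φ] at he
    have he' : ((q.2 * q'.1 : ℕ) : ZMod p) = ((q'.2 * q.1 : ℕ) : ZMod p) := by
      push_cast
      field_simp at he
      linear_combination he
    rw [ZMod.natCast_eq_natCast_iff'] at he'
    rwa [Nat.mod_eq_of_lt, Nat.mod_eq_of_lt] at he'
    · exact lt_of_le_of_lt (Nat.mul_le_mul n2' a2) hHA
    · exact lt_of_le_of_lt (Nat.mul_le_mul n2 a2') hHA
  have h2 : ((Z ×ˢ Z).filter fun w => φ w.1 = φ w.2).card ≤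
      (Z.sigma fun q => (q.2 * q.1).divisors).card := by
    refine Finset.card_le_card_of_injOn (fun w => ⟨(w.2.1, w.1.2), w.1.1⟩) ?_ ?_
    · intro w hw
      simp only [Finset.coe_filter, Finset.mem_product, Set.mem_ofPred_eq] at hw
      obtain ⟨⟨hw1, hw2⟩, he⟩ := hw
      have hc := hcross _ hw1 _ hw2 he
      obtain ⟨⟨a1, a2⟩, n1, n2⟩ := hmem _ hw1
      obtain ⟨⟨a1', a2'⟩, n1', n2'⟩ := hmem _ hw2
      simp only [Finset.coe_sigma, Set.mem_sigma_iff, Finset.mem_coe, Nat.mem_divisors, hZ,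
        Finset.mem_product, Finset.mem_Icc]
      refine ⟨⟨⟨a1', a2'⟩, n1, n2⟩, ?_, ?_⟩
      · rw [hc]; exact dvd_mul_left _ _
      · positivity
    · rintro ⟨⟨a, n⟩, ⟨a', n'⟩⟩ hw ⟨⟨b, m⟩, ⟨b', m'⟩⟩ hw' heq
      simp only [Finset.coe_filter, Finset.mem_product, Set.mem_ofPred_eq] at hw hw'
      have hc := hcross _ hw.1.1 _ hw.1.2 hw.2
      have hc' := hcross _ hw'.1.1 _ hw'.1.2 hw'.2
      obtain ⟨⟨a1, a2⟩, -⟩ := hmem _ hw.1.1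
      simp only [Sigma.mk.injEq, Prod.mk.injEq, heq_eq_eq] at heq
      obtain ⟨⟨rfl, rfl⟩, rfl⟩ := heq
      simp only at hc hc' a1
      have : n' = m' := by
        have := hc.symm.trans hc'
        exact Nat.eq_of_mul_eq_mul_right (by omega) this
      rw [this]
  have h3 : ((Z.sigma fun q => (q.2 * q.1).divisors).card : ℝ) ≤ H * A * T := by
    rw [Finset.card_sigma, Nat.cast_sum]
    refine (Finset.sum_le_card_nsmul _ _ T ?_).trans ?_
    · intro q hq
      obtain ⟨⟨a1, a2⟩, n1, n2⟩ := hmem q hq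
      exact hT _ (by positivity) (lt_of_le_of_lt (Nat.mul_le_mul n2 a2) hHA)
    · simp only [hZ, Finset.card_product, Nat.card_Icc, Nat.add_sub_cancel, nsmul_eq_mul]
      push_cast
      apply le_of_eq; ring
  have h4 : ((((Z ×ˢ Z).filter fun w => φ w.1 = φ w.2).card : ℕ) : ℝ) ≤
      ((Z.sigma fun q => (q.2 * q.1).divisors).card : ℝ) := by exact_mod_cast h2
  rw [← h1] at h4
  push_cast at h4
  exact h4.trans h3

lemma holder_bound {ι κ : Type*} [Fintype κ] [DecidableEq κ] (Z : Finset ι) (φ : ι → κ)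
    (F : κ → ℝ) (hF : ∀ x, 0 ≤ F x) (r : ℕ) :
    (∑ q ∈ Z, F (φ q)) ^ (2 * (r + 1)) ≤ (Z.card : ℝ) ^ (2 * r) *
      ((∑ x, ((Z.filter fun q => φ q = x).card : ℝ) ^ 2) * ∑ x, F x ^ (2 * (r + 1))) := by
  have h1 : (∑ q ∈ Z, F (φ q)) ^ (r + 1) ≤ (Z.card : ℝ) ^ r * ∑ q ∈ Z, F (φ q) ^ (r + 1) := by
    exact pow_sum_le_card_mul_sum_pow (fun q _ => hF _) r
  have h2 : ∑ q ∈ Z, F (φ q) ^ (r + 1) =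
      ∑ x, ((Z.filter fun q => φ q = x).card : ℝ) * F x ^ (r + 1) := by
    rw [← Finset.sum_fiberwise Z φ]
    refine Finset.sum_congr rfl fun x _ => ?_
    rw [← nsmul_eq_mul, ← Finset.sum_const]
    refine Finset.sum_congr rfl fun q hq => ?_
    rw [(Finset.mem_filter.1 hq).2]
  have h3 := Finset.sum_mul_sq_le_sq_mul_sq Finset.univ
    (fun x => ((Z.filter fun q => φ q = x).card : ℝ)) (fun x => F x ^ (r + 1))
  have h0 : 0 ≤ ∑ q ∈ Z, F (φ q) := Finset.sum_nonneg fun q _ => hF _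
  calc (∑ q ∈ Z, F (φ q)) ^ (2 * (r + 1)) = ((∑ q ∈ Z, F (φ q)) ^ (r + 1)) ^ 2 := by
        rw [← pow_mul, mul_comm]
    _ ≤ ((Z.card : ℝ) ^ r * ∑ q ∈ Z, F (φ q) ^ (r + 1)) ^ 2 := by gcongr
    _ = (Z.card : ℝ) ^ (2 * r) * (∑ x, ((Z.filter fun q => φ q = x).card : ℝ) * F x ^ (r + 1)) ^ 2 := by
        rw [mul_pow, ← pow_mul, mul_comm r 2, h2]
    _ ≤ _ := by
        refine mul_le_mul_of_nonneg_left (h3.trans (le_of_eq ?_)) (by positivity)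
        congr 1
        refine Finset.sum_congr rfl fun x _ => ?_
        rw [← pow_mul, mul_comm]


lemma half_le_floor {x : ℝ} (hx : 1 ≤ x) : x ≤ 2 * (⌊x⌋₊ : ℝ) := by
  have h1 : 1 ≤ ⌊x⌋₊ := by rwa [Nat.one_le_floor_iff]
  have h2 := Nat.lt_floor_add_one x
  have h3 : (1 : ℝ) ≤ ⌊x⌋₊ := by exact_mod_cast h1
  linarith

/-- The Burgess bound. Here `t = p ^ (1 / (8 r ^ 2))`. -/
lemma burgess_bound (r : ℕ) (hr : 3 ≤ r) : ∃ K : ℝ, 1 ≤ K ∧ ∀ p : ℕ, [Fact p.Prime] → 81 ≤ p →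
    ∀ t : ℝ, 1 ≤ t → t ^ (8 * r ^ 2) = p → ∀ D n : ℕ, n * D + 1 = p → (D : ℝ) ^ 3 ≤ t ^ (4 * r) →
    ∀ χ : MulChar (ZMod p) ℂ, χ ^ D = 1 → χ ≠ 1 →
    ‖∑ k ∈ Finset.Icc 1 ⌊t ^ (2 * r ^ 2 + 8 * r)⌋₊, χ (k : ZMod p)‖ * t ≤
      K * (⌊t ^ (2 * r ^ 2 + 8 * r)⌋₊ : ℝ) := by
  obtain ⟨C, hC1, hC⟩ := divisor_bound (1 / (4 * r)) (by positivity)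
  set K0 : ℝ := 4 * C * (r ^ (2 * r) * 2 ^ r + 32 * r) with hK0
  have hr0 : (1 : ℝ) ≤ r := by exact_mod_cast (by omega : 1 ≤ r)
  have hK01 : 1 ≤ K0 := by
    have h1 : (0 : ℝ) ≤ r ^ (2 * r) * 2 ^ r := by positivity
    have : 1 ≤ C * (r ^ (2 * r) * 2 ^ r + 32 * r) := one_le_mul_of_one_le_of_one_le hC1 (by linarith)
    rw [hK0]; linarith
  refine ⟨K0 + 4, by linarith, ?_⟩
  intro p hp hp81 t ht1 htp D n hDn hD3 χ hχ hχ1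
  have ht0 : 0 < t := by linarith
  have hp0 : (0 : ℝ) < p := by rw [← htp]; positivity
  set H := ⌊t ^ (2 * r ^ 2 + 8 * r)⌋₊ with hH
  set A := ⌊t ^ (2 * r ^ 2)⌋₊ with hA
  set B := ⌊t ^ (4 * r)⌋₊ with hB
  have hHle : (H : ℝ) ≤ t ^ (2 * r ^ 2 + 8 * r) := Nat.floor_le (by positivity)
  have hAle : (A : ℝ) ≤ t ^ (2 * r ^ 2) := Nat.floor_le (by positivity)
  have hBle : (B : ℝ) ≤ t ^ (4 * r) := Nat.floor_le (by positivity)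
  have hHge : t ^ (2 * r ^ 2 + 8 * r) ≤ 2 * (H : ℝ) := half_le_floor (one_le_pow₀ ht1)
  have hAge : t ^ (2 * r ^ 2) ≤ 2 * (A : ℝ) := half_le_floor (one_le_pow₀ ht1)
  have hBge : t ^ (4 * r) ≤ 2 * (B : ℝ) := half_le_floor (one_le_pow₀ ht1)
  have ht1' : 1 < t := by
    refine lt_of_le_of_ne ht1 fun h => ?_
    rw [← h] at htp
    simp only [one_pow] at htp
    have : (1 : ℕ) = p := by exact_mod_cast htp
    omega
  have hA0 : (0 : ℝ) < A := by
    have : 0 < t ^ (2 * r ^ 2) := by positivity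
    linarith
  have hB0 : (0 : ℝ) < B := by
    have : 0 < t ^ (4 * r) := by positivity
    linarith
  have hH0 : (0 : ℝ) < H := by
    have : 0 < t ^ (2 * r ^ 2 + 8 * r) := by positivity
    linarith
  have hAp : A < p := by
    have : (A : ℝ) < p := by
      rw [← htp]
      refine lt_of_le_of_lt hAle (pow_lt_pow_right₀ ht1' (by nlinarith))
    exact_mod_cast this
  have hBp : B ≤ p := by
    have : (B : ℝ) ≤ p := by
      rw [← htp]
      refine hBle.trans (pow_le_pow_right₀ ht1 (by nlinarith))
    exact_mod_cast this
  have hHA : H * A < p := by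
    have : (H * A : ℝ) < p := by
      rw [← htp]
      calc (H * A : ℝ) ≤ t ^ (2 * r ^ 2 + 8 * r) * t ^ (2 * r ^ 2) := by gcongr
        _ = t ^ (4 * r ^ 2 + 8 * r) := by rw [← pow_add]; congr 1; ring
        _ < _ := pow_lt_pow_right₀ ht1' (by nlinarith)
    exact_mod_cast this
  have hsqrt : Real.sqrt p = t ^ (4 * r ^ 2) := by
    rw [← htp, show 8 * r ^ 2 = (4 * r ^ 2) * 2 by ring, pow_mul, Real.sqrt_sq (by positivity)]
  have hDp : (2 * D + 1) ^ 2 ≤ p := by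
    have hD1 : 1 ≤ D := by
      rcases Nat.eq_zero_or_pos D with h | h
      · subst h; omega
      · exact h
    have hD1' : (1 : ℝ) ≤ D := by exact_mod_cast hD1
    have h9 : (9 : ℝ) ≤ t ^ (4 * r ^ 2) := by
      rw [← hsqrt]
      refine Real.le_sqrt_of_sq_le ?_
      have : (81 : ℝ) ≤ p := by exact_mod_cast hp81
      linarith
    have : ((2 * D + 1) ^ 2 : ℝ) ≤ p := by
      calc ((2 * D + 1) ^ 2 : ℝ) ≤ (3 * D) ^ 2 := by gcongr; linarith
        _ = 9 * D ^ 2 := by ring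
        _ ≤ 9 * D ^ 3 := by gcongr <;> norm_num
        _ ≤ t ^ (4 * r ^ 2) * t ^ (4 * r) := by gcongr
        _ = t ^ (4 * r ^ 2 + 4 * r) := by rw [← pow_add]
        _ ≤ t ^ (8 * r ^ 2) := pow_le_pow_right₀ ht1 (by nlinarith)
        _ = p := htp
    exact_mod_cast this
  have hT : ∀ k : ℕ, k ≠ 0 → k < p → (k.divisors.card : ℝ) ≤ C * t ^ (2 * r) := by
    intro k hk hkp
    refine (hC k hk).trans ?_
    have h1 : (p : ℝ) ^ (1 / (4 * r) : ℝ) = t ^ (2 * r) := by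
      rw [← htp, ← Real.rpow_natCast, ← Real.rpow_natCast, ← Real.rpow_mul ht0.le]
      congr 1
      push_cast
      field_simp
      norm_num
    rw [← h1]
    have : (k : ℝ) ≤ p := by exact_mod_cast hkp.le
    gcongr
  have hmom := moment_bound hDn hDp hχ hχ1 r B (by omega) hBp
  have hen := energy_bound H A hHA _ hT
  have hsh := burgess_shift χ H A B hAp
  obtain ⟨s, rfl⟩ : ∃ s, r = s + 1 := ⟨r - 1, by omega⟩
  have hhol := holder_bound (Finset.Icc 1 A ×ˢ Finset.Icc 1 H)
    (fun q => (q.2 : ZMod p) * (q.1 : ZMod p)⁻¹)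
    (fun x => ‖∑ b ∈ Finset.range B, χ (x + b)‖) (fun _ => norm_nonneg _) s
  set r := s + 1 with hrs
  set W := ∑ q ∈ Finset.Icc 1 A ×ˢ Finset.Icc 1 H,
        ‖∑ b ∈ Finset.range B, χ ((q.2 : ZMod p) * (q.1 : ZMod p)⁻¹ + b)‖ with hW
  have hW0 : 0 ≤ W := Finset.sum_nonneg fun _ _ => norm_nonneg _
  have hcard : ((Finset.Icc 1 A ×ˢ Finset.Icc 1 H).card : ℝ) = H * A := by
    simp [mul_comm]
  rw [hcard] at hhol
  have h1 : W ^ (2 * r) ≤ (H * A : ℝ) ^ (2 * s) * ((H * A * (C * t ^ (2 * r))) *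
      (r ^ (2 * r) * B ^ r * p + B ^ (2 * r) * (32 * D ^ 3 * r * Real.sqrt p))) := by
    refine hhol.trans ?_
    gcongr
  have h2 : (C * t ^ (2 * r)) * (r ^ (2 * r) * B ^ r * p + B ^ (2 * r) *
      (32 * D ^ 3 * r * Real.sqrt p)) * t ^ (2 * r) ≤ K0 * (H * A) * B ^ (2 * r) := by
    have hBr : t ^ (4 * r ^ 2) ≤ 2 ^ r * (B : ℝ) ^ r := by
      rw [← mul_pow, show 4 * r ^ 2 = (4 * r) * r by ring, pow_mul]
      gcongr
    have hpp : (p : ℝ) ≤ t ^ (4 * r ^ 2) * (2 ^ r * (B : ℝ) ^ r) := by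
      calc (p : ℝ) = t ^ (4 * r ^ 2) * t ^ (4 * r ^ 2) := by
            rw [← htp, ← pow_add]; congr 1; ring
        _ ≤ _ := by gcongr
    have ht4 : 1 ≤ t ^ (4 * r) := one_le_pow₀ ht1
    calc _ ≤ (C * t ^ (2 * r)) * (r ^ (2 * r) * B ^ r * (t ^ (4 * r ^ 2) * (2 ^ r * (B : ℝ) ^ r))
          + B ^ (2 * r) * (32 * t ^ (4 * r) * r * t ^ (4 * r ^ 2))) * t ^ (2 * r) := by
          rw [hsqrt]; gcongr
      _ = C * B ^ (2 * r) * (t ^ (2 * r) * t ^ (2 * r)) * t ^ (4 * r ^ 2) *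
          (r ^ (2 * r) * 2 ^ r * 1 + 32 * r * t ^ (4 * r)) := by
          rw [two_mul r, pow_add (B : ℝ)]; ring
      _ ≤ C * B ^ (2 * r) * (t ^ (2 * r) * t ^ (2 * r)) * t ^ (4 * r ^ 2) *
          (r ^ (2 * r) * 2 ^ r * t ^ (4 * r) + 32 * r * t ^ (4 * r)) := by gcongr
      _ = C * B ^ (2 * r) * (r ^ (2 * r) * 2 ^ r + 32 * r) *
          (t ^ (2 * r ^ 2 + 8 * r) * t ^ (2 * r ^ 2)) := by ring
      _ ≤ C * B ^ (2 * r) * (r ^ (2 * r) * 2 ^ r + 32 * r) * ((2 * H) * (2 * A)) := by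
          gcongr
      _ = _ := by rw [hK0]; ring
  have h3 : (W * t) ^ (2 * r) ≤ (K0 * (H * A * B)) ^ (2 * r) := by
    calc (W * t) ^ (2 * r) = W ^ (2 * r) * t ^ (2 * r) := mul_pow _ _ _
      _ ≤ (H * A : ℝ) ^ (2 * s) * ((H * A * (C * t ^ (2 * r))) *
      (r ^ (2 * r) * B ^ r * p + B ^ (2 * r) * (32 * D ^ 3 * r * Real.sqrt p))) * t ^ (2 * r) := by
          gcongr
      _ = (H * A : ℝ) ^ (2 * s + 1) * ((C * t ^ (2 * r)) * (r ^ (2 * r) * B ^ r * p + B ^ (2 * r) *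
      (32 * D ^ 3 * r * Real.sqrt p)) * t ^ (2 * r)) := by ring
      _ ≤ (H * A : ℝ) ^ (2 * s + 1) * (K0 * (H * A) * B ^ (2 * r)) := by gcongr
      _ = K0 ^ 1 * (H * A * B : ℝ) ^ (2 * r) := by
          rw [mul_pow _ (B : ℝ), show 2 * r = 2 * s + 1 + 1 by omega, pow_succ (H * A : ℝ) (2 * s + 1)]
          ring
      _ ≤ K0 ^ (2 * r) * (H * A * B : ℝ) ^ (2 * r) := by
          gcongr ?_ * _
          exact pow_le_pow_right₀ hK01 (by omega)
      _ = _ := by rw [← mul_pow]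
  have h4 : W * t ≤ K0 * (H * A * B) :=
    le_of_pow_le_pow_left₀ (by omega) (by positivity) h3
  have h5 : (A * B : ℝ) * t ≤ 2 * H := by
    calc (A * B : ℝ) * t ≤ t ^ (2 * r ^ 2) * t ^ (4 * r) * t := by gcongr
      _ = t ^ (2 * r ^ 2 + 4 * r + 1) := by rw [← pow_add, ← pow_succ]
      _ ≤ t ^ (2 * r ^ 2 + 8 * r) := pow_le_pow_right₀ ht1 (by omega)
      _ ≤ _ := hHge
  have h6 : (A * B : ℝ) * (‖∑ k ∈ Finset.Icc 1 H, χ (k : ZMod p)‖ * t) ≤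
      (A * B) * ((K0 + 4) * H) := by
    calc (A * B : ℝ) * (‖∑ k ∈ Finset.Icc 1 H, χ (k : ZMod p)‖ * t)
        = (A * B * ‖∑ k ∈ Finset.Icc 1 H, χ (k : ZMod p)‖) * t := by ring
      _ ≤ (W + 2 * (A * B) ^ 2) * t := by gcongr
      _ = W * t + 2 * (A * B) * ((A * B) * t) := by ring
      _ ≤ K0 * (H * A * B) + 2 * (A * B) * (2 * H) := by gcongr
      _ = _ := by ring
  exact le_of_mul_le_mul_left h6 (by positivity)


lemma char_eq_one_iff {p : ℕ} [Fact p.Prime] {D n : ℕ} (hDn : n * D + 1 = p)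
    {χ : MulChar (ZMod p) ℂ} (hχ : orderOf χ = D) {y : ZMod p} (hy : y ≠ 0) :
    χ y = 1 ↔ y ^ n = 1 := by
  constructor
  · intro h
    obtain ⟨g, hg⟩ := exists_primRoot p
    have hgen : ∀ z : ZMod p, z ≠ 0 → ∃ m, g ^ m = z := by
      intro z hz
      have hz1 : z ^ (p - 1) = 1 := ZMod.pow_card_sub_one_eq_one hz
      have : NeZero (p - 1) := ⟨by have := (Fact.out : p.Prime).two_le; omega⟩
      obtain ⟨i, -, hi⟩ := hg.eq_pow_of_pow_eq_one hz1
      exact ⟨i, hi⟩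
    obtain ⟨m, rfl⟩ := hgen y hy
    have h1 : χ ^ m = 1 := by
      rw [MulChar.eq_one_iff]
      intro u
      obtain ⟨i, hi⟩ := hgen u u.ne_zero
      rw [MulChar.pow_apply_coe, ← hi, map_pow, ← pow_mul, mul_comm, pow_mul, ← map_pow, h, one_pow]
    have h2 : D ∣ m := hχ ▸ orderOf_dvd_of_pow_eq_one h1
    obtain ⟨m', rfl⟩ := h2
    rw [← pow_mul, show D * m' * n = (p - 1) * m' by rw [← hDn]; simp; ring, pow_mul,
      hg.pow_eq_one, one_pow]
  · intro h
    exact char_eq_one_of_pow hDn (hχ ▸ pow_orderOf_eq_one χ) h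

lemma equidist (r : ℕ) (hr : 3 ≤ r) : ∃ K : ℝ, 1 ≤ K ∧ ∀ p : ℕ, [Fact p.Prime] → 81 ≤ p →
    ∀ t : ℝ, 1 ≤ t → t ^ (8 * r ^ 2) = p → ∀ D n : ℕ, n * D + 1 = p → (D : ℝ) ^ 3 ≤ t ^ (4 * r) →
    ∀ c : ZMod p, c ≠ 0 →
    |(((Finset.Icc 1 ⌊t ^ (2 * r ^ 2 + 8 * r)⌋₊).filter
        fun k : ℕ => (k : ZMod p) ^ n = c ^ n).card : ℝ) -
      (⌊t ^ (2 * r ^ 2 + 8 * r)⌋₊ : ℝ) / D| * t ≤ K * (⌊t ^ (2 * r ^ 2 + 8 * r)⌋₊ : ℝ) := by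
  obtain ⟨K, hK1, hK⟩ := burgess_bound r hr
  refine ⟨K, hK1, ?_⟩
  intro p hp hp81 t ht1 htp D n hDn hD3 c hc
  have hK' := hK p hp81 t ht1 htp D n hDn hD3
  have ht0 : 0 < t := by linarith
  have hHp : ⌊t ^ (2 * r ^ 2 + 8 * r)⌋₊ < p := by
    have ht1' : 1 < t := by
      refine lt_of_le_of_ne ht1 fun h => ?_
      rw [← h] at htp
      simp only [one_pow] at htp
      have : (1 : ℕ) = p := by exact_mod_cast htp
      omega
    have : (⌊t ^ (2 * r ^ 2 + 8 * r)⌋₊ : ℝ) < p := by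
      rw [← htp]
      exact lt_of_le_of_lt (Nat.floor_le (by positivity))
        (pow_lt_pow_right₀ ht1' (by nlinarith))
    exact_mod_cast this
  set H := ⌊t ^ (2 * r ^ 2 + 8 * r)⌋₊ with hH
  have hD0 : 0 < D := by
    rcases Nat.eq_zero_or_pos D with h | h
    · subst h; omega
    · exact h
  have hcardu : Fintype.card (ZMod p) - 1 = n * D := by rw [ZMod.card]; omega
  obtain ⟨χ, hχ⟩ := MulChar.exists_mulChar_orderOf (ZMod p) (n := D) (R := ℂ)
    (by rw [hcardu]; exact dvd_mul_left _ _) (Complex.isPrimitiveRoot_exp D hD0.ne')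
  set N := ((Finset.Icc 1 H).filter fun k : ℕ => (k : ZMod p) ^ n = c ^ n).card with hN
  have hk0 : ∀ k ∈ Finset.Icc 1 H, (k : ZMod p) ≠ 0 := by
    intro k hk
    rw [Finset.mem_Icc] at hk
    rw [Ne, ZMod.natCast_eq_zero_iff]
    intro hd
    have := Nat.le_of_dvd (by omega) hd
    omega
  have hsum : ∀ k ∈ Finset.Icc 1 H, ∑ j ∈ Finset.range D, (χ ^ j) ((k : ZMod p) * c⁻¹) =
      if (k : ZMod p) ^ n = c ^ n then (D : ℂ) else 0 := by
    intro k hk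
    have hy : (k : ZMod p) * c⁻¹ ≠ 0 := mul_ne_zero (hk0 k hk) (inv_ne_zero hc)
    have hyu : IsUnit ((k : ZMod p) * c⁻¹) := hy.isUnit
    have e : ∀ j, (χ ^ j) ((k : ZMod p) * c⁻¹) = (χ ((k : ZMod p) * c⁻¹)) ^ j := by
      intro j
      obtain ⟨u, hu⟩ := hyu
      rw [← hu, MulChar.pow_apply_coe]
    simp_rw [e]
    have hiff : χ ((k : ZMod p) * c⁻¹) = 1 ↔ (k : ZMod p) ^ n = c ^ n := by
      rw [char_eq_one_iff hDn hχ hy, mul_pow, inv_pow, mul_inv_eq_one₀ (pow_ne_zero _ hc)]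
    split_ifs with h
    · rw [hiff.2 h]; simp
    · have hne : χ ((k : ZMod p) * c⁻¹) ≠ 1 := fun h' => h (hiff.1 h')
      rw [geom_sum_eq hne]
      have : (χ ((k : ZMod p) * c⁻¹)) ^ D = 1 := by
        rw [← e, ← hχ, pow_orderOf_eq_one, MulChar.one_apply hyu]
      rw [this]; simp
  have hDN : (D : ℂ) * N = ∑ j ∈ Finset.range D, (χ ^ j) c⁻¹ * ∑ k ∈ Finset.Icc 1 H,
      (χ ^ j) (k : ZMod p) := by
    calc (D : ℂ) * N = ∑ k ∈ Finset.Icc 1 H, if (k : ZMod p) ^ n = c ^ n then (D : ℂ) else 0 := by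
          rw [Finset.sum_ite, Finset.sum_const, Finset.sum_const_zero, hN, nsmul_eq_mul]
          ring
      _ = ∑ k ∈ Finset.Icc 1 H, ∑ j ∈ Finset.range D, (χ ^ j) ((k : ZMod p) * c⁻¹) :=
          Finset.sum_congr rfl fun k hk => (hsum k hk).symm
      _ = _ := by
          rw [Finset.sum_comm]
          refine Finset.sum_congr rfl fun j _ => ?_
          rw [Finset.mul_sum]
          refine Finset.sum_congr rfl fun k _ => ?_
          rw [map_mul, mul_comm]
  have hzero : (χ ^ 0) c⁻¹ * ∑ k ∈ Finset.Icc 1 H, (χ ^ 0) (k : ZMod p) = H := by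
    rw [pow_zero, MulChar.one_apply (inv_ne_zero hc).isUnit, one_mul,
      Finset.sum_congr rfl fun k hk => MulChar.one_apply (hk0 k hk).isUnit]
    simp
  obtain ⟨D', rfl⟩ : ∃ D', D = D' + 1 := ⟨D - 1, by omega⟩
  rw [Finset.sum_range_succ', hzero] at hDN
  have hterm : ∀ j ∈ Finset.range D', ‖(χ ^ (j + 1)) c⁻¹ * ∑ k ∈ Finset.Icc 1 H,
      (χ ^ (j + 1)) (k : ZMod p)‖ ≤ K * H / t := by
    intro j hj
    rw [Finset.mem_range] at hj
    rw [norm_mul, le_div_iff₀ ht0]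
    have h1 : χ ^ (j + 1) ≠ 1 := pow_ne_one_of_lt_orderOf (by omega) (by rw [hχ]; omega)
    have h2 : (χ ^ (j + 1)) ^ (D' + 1) = 1 := by
      rw [← pow_mul, mul_comm, pow_mul, ← hχ, pow_orderOf_eq_one, one_pow]
    calc _ ≤ 1 * ‖∑ k ∈ Finset.Icc 1 H, (χ ^ (j + 1)) (k : ZMod p)‖ * t := by
          gcongr
          exact DirichletCharacter.norm_le_one _ _
      _ ≤ _ := by rw [one_mul]; exact hK' _ h2 h1
  have hb : ‖((D' + 1 : ℕ) : ℂ) * N - H‖ ≤ (D' + 1 : ℕ) * (K * H / t) := by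
    rw [hDN, add_sub_cancel_right]
    refine (norm_sum_le _ _).trans ?_
    refine (Finset.sum_le_card_nsmul _ _ _ hterm).trans ?_
    rw [Finset.card_range, nsmul_eq_mul]
    gcongr
    omega
  have hb' : |((D' + 1 : ℕ) : ℝ) * N - H| ≤ (D' + 1 : ℕ) * (K * H / t) := by
    rw [← Real.norm_eq_abs, ← Complex.norm_real]
    push_cast at hb ⊢
    exact hb
  have hDpos : (0 : ℝ) < ((D' + 1 : ℕ) : ℝ) := by positivity
  have e1 : (N : ℝ) - H / (D' + 1 : ℕ) = (((D' + 1 : ℕ) : ℝ) * N - H) / (D' + 1 : ℕ) := by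
    field_simp
  rw [e1, abs_div, abs_of_pos hDpos, ← le_div_iff₀ ht0, div_le_iff₀ hDpos, mul_comm _ (((D' + 1 : ℕ) : ℝ))]
  exact hb'


lemma count_roots {p : ℕ} [Fact p.Prime] (m X : ℕ) (hm : 0 < m) :
    ((Finset.Icc 1 X).filter fun k : ℕ => (k : ZMod p) ^ m = 1).card ≤ m * (X / p + 1) := by
  classical
  have hc : (Polynomial.nthRootsFinset m (1 : ZMod p) ×ˢ Finset.range (X / p + 1)).card ≤
      m * (X / p + 1) := by
    rw [Finset.card_product, Finset.card_range]
    refine Nat.mul_le_mul_right _ ?_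
    rw [Polynomial.nthRootsFinset_def]
    exact (Multiset.toFinset_card_le _).trans (Polynomial.card_nthRoots _ _)
  refine le_trans (Finset.card_le_card_of_injOn (fun k => ((k : ZMod p), k / p)) ?_ ?_) hc
  · intro k hk
    simp only [Finset.coe_filter, Finset.mem_Icc, Set.mem_ofPred_eq] at hk
    simp only [Finset.coe_product, Set.mem_prod, Finset.mem_coe, Finset.mem_range,
      Polynomial.mem_nthRootsFinset hm]
    exact ⟨hk.2, Nat.lt_succ_of_le (Nat.div_le_div_right hk.1.2)⟩
  · intro a _ b _ hab
    simp only [Prod.mk.injEq, ZMod.natCast_eq_natCast_iff'] at hab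
    rw [← Nat.div_add_mod a p, ← Nat.div_add_mod b p, hab.1, hab.2]

lemma large_bound {p : ℕ} [Fact p.Prime] (m H : ℕ) (hm : 0 < m) (M : ℝ)
    (hM : ∀ k : ℕ, k ≠ 0 → k ≤ H ^ 4 → (k.divisors.card : ℝ) ≤ M) :
    ((((Finset.Icc 1 H).filter fun k : ℕ => (k : ZMod p) ^ m = 1).card : ℕ) : ℝ) ^ 4 ≤
      m * ((H : ℝ) ^ 4 / p + 1) * M ^ 4 := by
  classical
  set T := (Finset.Icc 1 H).filter fun k : ℕ => (k : ZMod p) ^ m = 1 with hT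
  set U := (Finset.Icc 1 (H ^ 4)).filter fun k : ℕ => (k : ZMod p) ^ m = 1 with hU
  have hmem : ∀ k ∈ T, (1 ≤ k ∧ k ≤ H) ∧ (k : ZMod p) ^ m = 1 := by
    intro k hk; simpa [hT] using hk
  have h1 : (T ×ˢ T ×ˢ T ×ˢ T).card ≤ (U.sigma fun P => P.divisors ×ˢ P.divisors ×ˢ
      P.divisors ×ˢ P.divisors).card := by
    refine Finset.card_le_card_of_injOn
      (fun w => ⟨w.1 * (w.2.1 * (w.2.2.1 * w.2.2.2)), w⟩) ?_ ?_
    · rintro ⟨a, b, c, d⟩ hw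
      simp only [Finset.coe_product, Set.mem_prod, Finset.mem_coe] at hw
      obtain ⟨ha, hb, hc, hd⟩ := hw
      obtain ⟨⟨a1, a2⟩, a3⟩ := hmem _ ha
      obtain ⟨⟨b1, b2⟩, b3⟩ := hmem _ hb
      obtain ⟨⟨c1, c2⟩, c3⟩ := hmem _ hc
      obtain ⟨⟨d1, d2⟩, d3⟩ := hmem _ hd
      have hpos : 0 < a * (b * (c * d)) := by positivity
      simp only [Finset.coe_sigma, Set.mem_sigma_iff, Finset.mem_coe, Finset.mem_product,
        Nat.mem_divisors, hU, Finset.mem_filter, Finset.mem_Icc]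
      refine ⟨⟨⟨hpos, ?_⟩, ?_⟩, ⟨Dvd.intro _ rfl, hpos.ne'⟩, ⟨⟨a * (c * d), by ring⟩, hpos.ne'⟩,
        ⟨⟨a * (b * d), by ring⟩, hpos.ne'⟩, ⟨⟨a * (b * c), by ring⟩, hpos.ne'⟩⟩
      · calc a * (b * (c * d)) ≤ H * (H * (H * H)) := by gcongr
          _ = H ^ 4 := by ring
      · push_cast
        rw [mul_pow, mul_pow, mul_pow, a3, b3, c3, d3]; simp
    · intro w _ w' _ h
      simp only [Sigma.mk.injEq] at h
      exact eq_of_heq h.2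
  rw [Finset.card_sigma] at h1
  simp only [Finset.card_product] at h1
  have h2 : ((T.card : ℕ) : ℝ) ^ 4 ≤ ∑ P ∈ U, ((P.divisors.card : ℕ) : ℝ) ^ 4 := by
    have h1' : ((T.card * (T.card * (T.card * T.card)) : ℕ) : ℝ) ≤
      ((∑ P ∈ U, P.divisors.card * (P.divisors.card * (P.divisors.card * P.divisors.card)) : ℕ) : ℝ) := by
      exact_mod_cast h1
    push_cast at h1'
    calc ((T.card : ℕ) : ℝ) ^ 4 = (T.card * (T.card * (T.card * T.card)) : ℝ) := by ring
      _ ≤ _ := h1'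
      _ = _ := Finset.sum_congr rfl fun _ _ => by ring
  refine h2.trans ?_
  refine (Finset.sum_le_card_nsmul _ _ (M ^ 4) ?_).trans ?_
  · intro P hP
    simp only [hU, Finset.mem_filter, Finset.mem_Icc] at hP
    gcongr
    exact hM P (by omega) hP.1.2
  · rw [nsmul_eq_mul]
    have hM4 : 0 ≤ M ^ 4 := by positivity
    refine mul_le_mul_of_nonneg_right ?_ hM4
    have h3 : (U.card : ℝ) ≤ ((m * (H ^ 4 / p + 1) : ℕ) : ℝ) := by
      exact Nat.cast_le.2 (count_roots m (H ^ 4) hm)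
    refine h3.trans ?_
    push_cast
    gcongr
    have := @Nat.cast_div_le ℝ _ _ _ (H ^ 4) p
    push_cast at this
    exact this


lemma medium_subset {p : ℕ} [Fact p.Prime] {g : ZMod p} (hg : IsPrimitiveRoot g (p - 1))
    (hg0 : g ≠ 0) {Q q n : ℕ}
    (hcop : Nat.Coprime Q q) (hn : n * (Q * q) = p - 1) (H : ℕ) : ∃ c : ZMod p, c ≠ 0 ∧
    (((Finset.Icc 1 H).filter fun k : ℕ => (k : ZMod p) ^ (n * q) = g ^ (n * q)).filter
      fun k : ℕ => (k : ZMod p) ^ (n * Q) = 1) ⊆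
    (Finset.Icc 1 H).filter fun k : ℕ => (k : ZMod p) ^ n = c ^ n := by
  obtain ⟨e, he1, he2⟩ := Nat.chineseRemainder hcop 1 0
  refine ⟨g ^ e, pow_ne_zero _ hg0, ?_⟩
  intro k hk
  simp only [Finset.mem_filter] at hk ⊢
  obtain ⟨⟨hk1, hk2⟩, hk3⟩ := hk
  refine ⟨hk1, ?_⟩
  have hgp : g ^ (n * (Q * q)) = 1 := by rw [hn]; exact hg.pow_eq_one
  have h1 : (g ^ e) ^ (n * q) = g ^ (n * q) := by
    have : (g ^ (n * q)) ^ Q = 1 := by rw [← pow_mul, ← hgp]; congr 1; ring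
    rw [← pow_mul, mul_comm, pow_mul]
    conv_rhs => rw [← pow_one (g ^ (n * q))]
    exact pow_eq_pow_of_modEq he1 this
  have h2 : (g ^ e) ^ (n * Q) = 1 := by
    obtain ⟨f, rfl⟩ := (Nat.modEq_zero_iff_dvd.1 he2)
    rw [← pow_mul, show q * f * (n * Q) = (n * (Q * q)) * f by ring, pow_mul, hgp, one_pow]
  have hc0 : (g ^ e) ^ n ≠ 0 := pow_ne_zero _ (pow_ne_zero _ hg0)
  set z := (k : ZMod p) ^ n / (g ^ e) ^ n with hz
  have hz1 : z ^ q = 1 := by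
    rw [hz, div_pow, ← pow_mul, ← pow_mul, hk2, h1, div_self (pow_ne_zero _ hg0)]
  have hz2 : z ^ Q = 1 := by
    rw [hz, div_pow, ← pow_mul, ← pow_mul, hk3, h2, div_one]
  have hz3 : z = 1 := by
    have h := Nat.dvd_gcd (orderOf_dvd_of_pow_eq_one hz2) (orderOf_dvd_of_pow_eq_one hz1)
    rw [hcop] at h
    exact orderOf_eq_one_iff.1 (Nat.dvd_one.1 h)
  rw [hz, div_eq_one_iff_eq hc0] at hz3
  exact hz3

/-- A sieve: if the sifted count is positive, there is a small primitive root. -/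
lemma sieve {p : ℕ} [Fact p.Prime] {g : ZMod p} (hg : IsPrimitiveRoot g (p - 1))
    (Sm : Finset ℕ) (H : ℕ) {n0 : ℕ}
    (hn0 : n0 * (∏ q ∈ Sm, q) = p - 1)
    (hcount : ∑ q ∈ (p - 1).primeFactors \ Sm,
      (((Finset.Icc 1 H).filter fun k : ℕ => (k : ZMod p) ^ n0 = g ^ n0).filter
        fun k : ℕ => (k : ZMod p) ^ ((p - 1) / q) = 1).card <
      ((Finset.Icc 1 H).filter fun k : ℕ => (k : ZMod p) ^ n0 = g ^ n0).card) :
    ∃ k ∈ Finset.Icc 1 H, orderOf (k : ZMod p) = p - 1 := by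
  classical
  have hp2 := (Fact.out : p.Prime).two_le
  set S0 := (Finset.Icc 1 H).filter fun k : ℕ => (k : ZMod p) ^ n0 = g ^ n0 with hS0
  have h1 : (((p - 1).primeFactors \ Sm).biUnion fun q =>
      S0.filter fun k : ℕ => (k : ZMod p) ^ ((p - 1) / q) = 1).card < S0.card :=
    lt_of_le_of_lt Finset.card_biUnion_le hcount
  obtain ⟨k, hk, hk'⟩ := Finset.exists_mem_notMem_of_card_lt_card h1
  have hkS := Finset.mem_filter.1 hk
  have hg0 : g ≠ 0 := hg.ne_zero (by omega)
  refine ⟨k, hkS.1, ?_⟩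
  have hkpow : (k : ZMod p) ^ (p - 1) = 1 := by
    rw [← hn0, pow_mul, hkS.2, ← pow_mul, hn0]; exact hg.pow_eq_one
  refine orderOf_eq_of_pow_and_pow_div_prime (by omega) hkpow ?_
  intro q hq hqd hone
  have hqP : q ∈ (p - 1).primeFactors := by
    rw [Nat.mem_primeFactors]; exact ⟨hq, hqd, by omega⟩
  by_cases hqS : q ∈ Sm
  · obtain ⟨w, hw⟩ := Finset.dvd_prod_of_mem (fun q => q) hqS
    have e : (p - 1) / q = n0 * w := by
      rw [← hn0, hw]
      exact Nat.div_eq_of_eq_mul_right hq.pos (by ring)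
    rw [e, pow_mul, hkS.2, ← pow_mul, ← e] at hone
    have := hg.dvd_of_pow_eq_one _ hone
    have hlt : (p - 1) / q < p - 1 := Nat.div_lt_self (by omega) hq.one_lt
    have hpos : 0 < (p - 1) / q := Nat.div_pos (Nat.le_of_dvd (by omega) hqd) hq.pos
    exact absurd (Nat.le_of_dvd hpos this) (by omega)
  · refine hk' (Finset.mem_biUnion.2 ⟨q, Finset.mem_sdiff.2 ⟨hqP, hqS⟩, ?_⟩)
    exact Finset.mem_filter.2 ⟨hk, hone⟩


lemma card_log_le {m : ℕ} (hm : m ≠ 0) (F : Finset ℕ) (hF : F ⊆ m.primeFactors) (y : ℕ)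
    (hy : 1 ≤ y) (hFy : ∀ q ∈ F, y ≤ q) : (F.card : ℝ) * Real.log y ≤ Real.log m := by
  have h1 : y ^ F.card ≤ m := by
    calc y ^ F.card ≤ ∏ q ∈ F, q := Finset.pow_card_le_prod F (fun q => q) y hFy
      _ ≤ ∏ q ∈ m.primeFactors, q := by
          refine Finset.prod_le_prod_of_subset_of_one_le' hF ?_
          intro q hq _
          exact (Nat.prime_of_mem_primeFactors hq).one_le
      _ ≤ m := Nat.le_of_dvd (Nat.pos_of_ne_zero hm) (Nat.prod_primeFactors_dvd m)
  have hy0 : (0 : ℝ) < y := by exact_mod_cast hy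
  have h2 : (y : ℝ) ^ F.card ≤ m := by exact_mod_cast h1
  rw [← Real.log_pow]
  exact Real.log_le_log (by positivity) h2

lemma large_primes (r : ℕ) (hr : 4 ≤ r) : ∃ C : ℝ, 1 ≤ C ∧ ∀ p : ℕ, [Fact p.Prime] →
    ∀ u : ℝ, 2 ≤ u → u ^ (32 * r ^ 2) = p → ∀ q : ℕ, q ∣ p - 1 → u ^ 16 < q →
    (((Finset.Icc 1 ⌊(u ^ 4) ^ (2 * r ^ 2 + 8 * r)⌋₊).filter
      fun k : ℕ => (k : ZMod p) ^ ((p - 1) / q) = 1).card : ℝ) * u ^ 3 ≤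
      2 * C * (⌊(u ^ 4) ^ (2 * r ^ 2 + 8 * r)⌋₊ : ℝ) := by
  obtain ⟨C, hC1, hC⟩ := divisor_bound (1 / (16 * (2 * r ^ 2 + 8 * r))) (by positivity)
  refine ⟨C, hC1, ?_⟩
  intro p hp u hu2 hup q hq huq
  have hp2 := hp.out.two_le
  have hu0 : 0 < u := by linarith
  have hp0 : (0 : ℝ) < p := by rw [← hup]; positivity
  have hge : (u ^ 4) ^ (2 * r ^ 2 + 8 * r) ≤ 2 * (⌊(u ^ 4) ^ (2 * r ^ 2 + 8 * r)⌋₊ : ℝ) :=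
    half_le_floor (one_le_pow₀ (one_le_pow₀ (by linarith)))
  have hle : (⌊(u ^ 4) ^ (2 * r ^ 2 + 8 * r)⌋₊ : ℝ) ≤ (u ^ 4) ^ (2 * r ^ 2 + 8 * r) :=
    Nat.floor_le (by positivity)
  set H := ⌊(u ^ 4) ^ (2 * r ^ 2 + 8 * r)⌋₊ with hH
  have hHp : (p : ℝ) ≤ (H : ℝ) ^ 4 := by
    have h1 : u ^ (8 * r ^ 2) ≤ H := by
      have h2 : 2 * u ^ (8 * r ^ 2) ≤ (u ^ 4) ^ (2 * r ^ 2 + 8 * r) := by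
        calc 2 * u ^ (8 * r ^ 2) ≤ u * u ^ (8 * r ^ 2) := by gcongr
          _ = u ^ (8 * r ^ 2 + 1) := (pow_succ' u _).symm
          _ ≤ u ^ (4 * (2 * r ^ 2 + 8 * r)) := pow_le_pow_right₀ (by linarith) (by nlinarith)
          _ = _ := by rw [pow_mul]
      linarith
    calc (p : ℝ) = (u ^ (8 * r ^ 2)) ^ 4 := by rw [← hup, ← pow_mul]; congr 1; ring
      _ ≤ _ := by gcongr
  have hM : ∀ k : ℕ, k ≠ 0 → k ≤ H ^ 4 → (k.divisors.card : ℝ) ≤ C * u := by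
    intro k hk hkH
    refine (hC k hk).trans ?_
    have h1 : (k : ℝ) ≤ u ^ (16 * (2 * r ^ 2 + 8 * r)) := by
      calc (k : ℝ) ≤ (H : ℝ) ^ 4 := by exact_mod_cast hkH
        _ ≤ ((u ^ 4) ^ (2 * r ^ 2 + 8 * r)) ^ 4 := by gcongr
        _ = _ := by rw [← pow_mul, ← pow_mul]; congr 1; ring
    have h2 : (u ^ (16 * (2 * r ^ 2 + 8 * r))) ^ (1 / (16 * (2 * r ^ 2 + 8 * r)) : ℝ) = u := by
      rw [← Real.rpow_natCast, ← Real.rpow_mul hu0.le]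
      conv_rhs => rw [← Real.rpow_one u]
      congr 1
      push_cast
      have : (16 * (2 * r ^ 2 + 8 * r) : ℝ) ≠ 0 := by positivity
      field_simp
    gcongr
    calc (k : ℝ) ^ (1 / (16 * (2 * r ^ 2 + 8 * r)) : ℝ) ≤
        (u ^ (16 * (2 * r ^ 2 + 8 * r))) ^ (1 / (16 * (2 * r ^ 2 + 8 * r)) : ℝ) := by gcongr
      _ = u := h2
  have hq0 : 0 < q := by
    have : (0 : ℝ) < q := lt_trans (by positivity) huq
    exact_mod_cast this
  have hm0 : 0 < (p - 1) / q := Nat.div_pos (Nat.le_of_dvd (by omega) hq) hq0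
  have hlb := large_bound (p := p) ((p - 1) / q) H hm0 (C * u) hM
  set T := (((Finset.Icc 1 H).filter fun k : ℕ => (k : ZMod p) ^ ((p - 1) / q) = 1).card : ℝ) with hT
  have hT0 : 0 ≤ T := by positivity
  have hmq : (((p - 1) / q : ℕ) : ℝ) * u ^ 16 ≤ p := by
    have h1 : ((p - 1) / q) * q ≤ p := by rw [Nat.div_mul_cancel hq]; omega
    have h2 : (((p - 1) / q : ℕ) : ℝ) * q ≤ p := by exact_mod_cast h1
    refine le_trans ?_ h2
    gcongr
  have h1 : 1 ≤ (H : ℝ) ^ 4 / p := by rw [le_div_iff₀ hp0]; linarith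
  have h2 : (T * u ^ 4) ^ 4 ≤ (2 * (H * (C * u))) ^ 4 := by
    calc (T * u ^ 4) ^ 4 = T ^ 4 * u ^ 16 := by ring
      _ ≤ (((p - 1) / q : ℕ) : ℝ) * ((H : ℝ) ^ 4 / p + 1) * (C * u) ^ 4 * u ^ 16 := by gcongr
      _ = ((((p - 1) / q : ℕ) : ℝ) * u ^ 16) * ((H : ℝ) ^ 4 / p + 1) * (C * u) ^ 4 := by ring
      _ ≤ p * ((H : ℝ) ^ 4 / p + (H : ℝ) ^ 4 / p) * (C * u) ^ 4 := by gcongr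
      _ = 2 * (H * (C * u)) ^ 4 := by field_simp; ring
      _ ≤ 2 ^ 4 * (H * (C * u)) ^ 4 := by gcongr; norm_num
      _ = _ := by rw [mul_pow 2]
  have h3 : T * u ^ 4 ≤ 2 * (H * (C * u)) := le_of_pow_le_pow_left₀ (by norm_num) (by positivity) h2
  refine le_of_mul_le_mul_right ?_ hu0
  calc T * u ^ 3 * u = T * u ^ 4 := by ring
    _ ≤ _ := h3
    _ = _ := by ring

lemma eventually_params (r : ℕ) (E : ℝ) (hE : 1 ≤ E) : ∃ u0 : ℝ, ∀ u : ℝ, u0 ≤ u →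
    81 ≤ u ∧ 128 * (r : ℝ) ^ 2 ≤ Real.log (⌊Real.log u⌋₊ : ℝ) ∧ E * (2 + Real.log u) < u ∧
    1 ≤ Real.log u := by
  have h1 : ∀ᶠ u : ℝ in Filter.atTop, 81 ≤ u := Filter.eventually_ge_atTop 81
  have h2 : ∀ᶠ u : ℝ in Filter.atTop, 128 * (r : ℝ) ^ 2 ≤ Real.log (⌊Real.log u⌋₊ : ℝ) :=
    ((Real.tendsto_log_atTop.comp tendsto_natCast_atTop_atTop).comp
      ((tendsto_nat_floor_atTop (α := ℝ)).comp Real.tendsto_log_atTop)).eventually_ge_atTop _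
  have h3 : ∀ᶠ u : ℝ in Filter.atTop, ‖Real.log u‖ ≤ (1 / (2 * E)) * ‖id u‖ :=
    Real.isLittleO_log_id_atTop.bound (by positivity)
  have h4 : ∀ᶠ u : ℝ in Filter.atTop, 4 * E < u := Filter.eventually_gt_atTop _
  have h5 : ∀ᶠ u : ℝ in Filter.atTop, 1 ≤ Real.log u := Real.tendsto_log_atTop.eventually_ge_atTop _
  obtain ⟨u0, hu0⟩ := Filter.eventually_atTop.1 (h1.and (h2.and (h3.and (h4.and h5))))
  refine ⟨u0, fun u hu => ?_⟩
  obtain ⟨a1, a2, a3, a4, a5⟩ := hu0 u hu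
  refine ⟨a1, a2, ?_, a5⟩
  rw [Real.norm_of_nonneg (by linarith), id, Real.norm_of_nonneg (by linarith)] at a3
  have : E * Real.log u ≤ u / 2 := by
    calc E * Real.log u ≤ E * (1 / (2 * E) * u) := by gcongr
      _ = u / 2 := by field_simp
  linarith


lemma exists_small_root (r : ℕ) (hr : 4 ≤ r) : ∃ u0 : ℝ, ∀ p : ℕ, [Fact p.Prime] →
    ∀ u : ℝ, u0 ≤ u → u ^ (32 * r ^ 2) = p →
    ∃ k ∈ Finset.Icc 1 ⌊(u ^ 4) ^ (2 * r ^ 2 + 8 * r)⌋₊, orderOf (k : ZMod p) = p - 1 := by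
  classical
  obtain ⟨K, hK1, hK⟩ := equidist r (by omega)
  obtain ⟨C, hC1, hC⟩ := large_primes r hr
  set E := K + 2 * C with hE
  obtain ⟨u0, hu0⟩ := eventually_params r E (by linarith)
  refine ⟨u0, ?_⟩
  intro p hp u huu hup
  obtain ⟨hu81, hlogy, hEu, hl1⟩ := hu0 u huu
  have hp2 := hp.out.two_le
  have hupos : 0 < u := by linarith
  have hu1 : 1 ≤ u := by linarith
  have hp81 : 81 ≤ p := by
    have : (81 : ℝ) ≤ p := by
      rw [← hup]
      refine hu81.trans ?_
      exact le_self_pow₀ hu1 (by positivity)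
    exact_mod_cast this
  have ht : (u ^ 4) ^ (8 * r ^ 2) = p := by rw [← hup, ← pow_mul]; congr 1; ring
  have hK' := hK p hp81 (u ^ 4) (one_le_pow₀ hu1) ht
  have hC' := hC p u (by linarith) hup
  have hHge : (u ^ 4) ^ (2 * r ^ 2 + 8 * r) ≤ 2 * (⌊(u ^ 4) ^ (2 * r ^ 2 + 8 * r)⌋₊ : ℝ) :=
    half_le_floor (one_le_pow₀ (one_le_pow₀ (by linarith)))
  set H := ⌊(u ^ 4) ^ (2 * r ^ 2 + 8 * r)⌋₊ with hH
  have hH0 : (0 : ℝ) < H := by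
    have : 0 < (u ^ 4) ^ (2 * r ^ 2 + 8 * r) := by positivity
    linarith
  set y := ⌊Real.log u⌋₊ with hy
  have hy1 : 1 ≤ y := by rwa [hy, Nat.one_le_floor_iff]
  have hyle : (y : ℝ) ≤ Real.log u := Nat.floor_le (by linarith)
  have hyge : Real.log u ≤ 2 * y := half_le_floor hl1
  have hy0 : (0 : ℝ) < y := by exact_mod_cast hy1
  obtain ⟨g, hg⟩ := exists_primRoot p
  have hg0 : g ≠ 0 := hg.ne_zero (by omega)
  set P := (p - 1).primeFactors with hP
  set Sm := P.filter fun q => q ≤ y with hSm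
  set Q := ∏ q ∈ Sm, q with hQ
  have hQdvd : Q ∣ p - 1 :=
    (Finset.prod_dvd_prod_of_subset _ _ _ (Finset.filter_subset _ _)).trans
      (Nat.prod_primeFactors_dvd (p - 1))
  have hQ0 : 0 < Q := Nat.pos_of_dvd_of_pos hQdvd (by omega)
  have hQ0' : (0 : ℝ) < Q := by exact_mod_cast hQ0
  have hQu : (Q : ℝ) ≤ u ^ 2 := by
    have h1 : Q ≤ 4 ^ y := by
      refine le_trans ?_ (primorial_le_four_pow y)
      unfold primorial
      refine Finset.prod_le_prod_of_subset_of_one_le' ?_ ?_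
      · intro q hq
        rw [hSm, Finset.mem_filter] at hq
        simp only [Finset.mem_filter, Finset.mem_range]
        exact ⟨by omega, Nat.prime_of_mem_primeFactors hq.1⟩
      · intro q hq _
        exact (Finset.mem_filter.1 hq).2.one_le
    have h2 : (4 : ℝ) ≤ Real.exp 2 := by
      have h3 : (2 : ℝ) ≤ Real.exp 1 := by linarith [Real.add_one_le_exp (1 : ℝ)]
      calc (4 : ℝ) = 2 * 2 := by norm_num
        _ ≤ Real.exp 1 * Real.exp 1 := by gcongr
        _ = Real.exp 2 := by rw [← Real.exp_add]; norm_num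
    calc (Q : ℝ) ≤ 4 ^ y := by exact_mod_cast h1
      _ ≤ (Real.exp 2) ^ y := by gcongr
      _ = Real.exp (y * 2) := by rw [Real.exp_nat_mul]
      _ ≤ Real.exp (Real.log u * 2) := by gcongr
      _ = u ^ 2 := by
          rw [mul_comm, two_mul, Real.exp_add, Real.exp_log hupos, sq]
  obtain ⟨n0, hn0⟩ := hQdvd
  have hn0' : n0 * Q = p - 1 := by rw [hn0, mul_comm]
  have hpow : ∀ a : ℕ, a ≤ 54 → u ^ a ≤ (u ^ 4) ^ (4 * r) := by
    intro a ha
    rw [← pow_mul]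
    exact pow_le_pow_right₀ hu1 (by omega)
  refine sieve hg Sm H hn0' ?_
  set S0 := (Finset.Icc 1 H).filter fun k : ℕ => (k : ZMod p) ^ n0 = g ^ n0 with hS0
  -- lower bound for the main count
  have hmain : (H : ℝ) / Q - E * H / u ^ 3 ≤ S0.card := by
    have h1 := hK' Q n0 (by omega) (by
      calc (Q : ℝ) ^ 3 ≤ (u ^ 2) ^ 3 := by gcongr
        _ = u ^ 6 := by ring
        _ ≤ _ := hpow 6 (by norm_num)) g hg0
    rw [← hS0, ← le_div_iff₀ (by positivity)] at h1
    have h2 := (abs_le.1 h1).1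
    have h3 : K * H / u ^ 4 ≤ E * H / u ^ 3 := by
      have : K ≤ E := by linarith
      have h4 : u ^ 3 ≤ u ^ 4 := pow_le_pow_right₀ hu1 (by norm_num)
      gcongr
    linarith
  -- bound for each bad prime
  have hbad : ∀ q ∈ P \ Sm, ((S0.filter fun k : ℕ => (k : ZMod p) ^ ((p - 1) / q) = 1).card : ℝ)
      ≤ (H : ℝ) / Q / y + E * H / u ^ 3 := by
    intro q hq
    obtain ⟨hqP, hqS⟩ := Finset.mem_sdiff.1 hq
    have hqy : y < q := by
      by_contra h
      exact hqS (Finset.mem_filter.2 ⟨hqP, not_lt.1 h⟩)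
    have hqprime := Nat.prime_of_mem_primeFactors hqP
    have hqd := Nat.dvd_of_mem_primeFactors hqP
    have hqy' : (y : ℝ) ≤ q := by exact_mod_cast hqy.le
    by_cases hbig : u ^ 16 < (q : ℝ)
    · have h1 := hC' q hqd hbig
      rw [← le_div_iff₀ (by positivity)] at h1
      have h2 : ((S0.filter fun k : ℕ => (k : ZMod p) ^ ((p - 1) / q) = 1).card : ℝ) ≤
          (((Finset.Icc 1 H).filter fun k : ℕ => (k : ZMod p) ^ ((p - 1) / q) = 1).card : ℝ) := by
        refine Nat.cast_le.2 (Finset.card_le_card ?_)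
        exact Finset.filter_subset_filter _ (Finset.filter_subset _ _)
      have h3 : 2 * C * H / u ^ 3 ≤ E * H / u ^ 3 := by
        have : 2 * C ≤ E := by linarith
        gcongr
      have h4 : 0 ≤ (H : ℝ) / Q / y := by positivity
      linarith
    · rw [not_lt] at hbig
      have hcop : Nat.Coprime Q q := by
        refine Nat.Coprime.prod_left fun s hs => ?_
        have hs' := Finset.mem_filter.1 hs
        rw [Nat.coprime_primes (Nat.prime_of_mem_primeFactors hs'.1) hqprime]
        rintro rfl
        omega
      have hQq : Q * q ∣ p - 1 := hcop.mul_dvd_of_dvd_of_dvd ⟨n0, hn0⟩ hqd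
      obtain ⟨n, hn⟩ := hQq
      have hn' : n * (Q * q) = p - 1 := by rw [hn, mul_comm]
      have e1 : n0 = n * q := by
        refine Nat.eq_of_mul_eq_mul_right hQ0 ?_
        rw [hn0', ← hn']; ring
      have e2 : (p - 1) / q = n * Q :=
        Nat.div_eq_of_eq_mul_right hqprime.pos (by rw [← hn']; ring)
      obtain ⟨c, hc0, hc⟩ := medium_subset hg hg0 hcop hn' H
      have h1 := hK' (Q * q) n (by omega) (by
        push_cast
        calc ((Q : ℝ) * q) ^ 3 ≤ (u ^ 2 * u ^ 16) ^ 3 := by gcongr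
          _ = u ^ 54 := by ring
          _ ≤ _ := hpow 54 le_rfl) c hc0
      rw [← le_div_iff₀ (by positivity)] at h1
      have h2 := (abs_le.1 h1).2
      have h3 : K * H / u ^ 4 ≤ E * H / u ^ 3 := by
        have : K ≤ E := by linarith
        have h4 : u ^ 3 ≤ u ^ 4 := pow_le_pow_right₀ hu1 (by norm_num)
        gcongr
      have h5 : (H : ℝ) / ((Q * q : ℕ) : ℝ) ≤ H / Q / y := by
        rw [div_div]
        push_cast
        gcongr
      have h6 : ((S0.filter fun k : ℕ => (k : ZMod p) ^ ((p - 1) / q) = 1).card : ℝ) ≤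
          (((Finset.Icc 1 H).filter fun k : ℕ => (k : ZMod p) ^ n = c ^ n).card : ℝ) := by
        refine Nat.cast_le.2 (Finset.card_le_card ?_)
        rw [e2, hS0, e1]
        exact hc
      linarith
  have hcardR : ((P \ Sm).card : ℝ) ≤ y / 2 := by
    have h1 := card_log_le (m := p - 1) (by omega) (P \ Sm) Finset.sdiff_subset y hy1 (by
      intro q hq
      obtain ⟨hqP, hqS⟩ := Finset.mem_sdiff.1 hq
      by_contra h
      exact hqS (Finset.mem_filter.2 ⟨hqP, by omega⟩))
    have h2 : Real.log ((p - 1 : ℕ) : ℝ) ≤ 32 * r ^ 2 * Real.log u := by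
      have : Real.log ((p - 1 : ℕ) : ℝ) ≤ Real.log p := by
        refine Real.log_le_log ?_ ?_
        · exact_mod_cast (by omega : 0 < p - 1)
        · exact_mod_cast (by omega : p - 1 ≤ p)
      refine this.trans (le_of_eq ?_)
      rw [← hup, Real.log_pow]
      push_cast
      ring
    have h3 : ((P \ Sm).card : ℝ) * (128 * (r : ℝ) ^ 2) ≤ (y / 2) * (128 * (r : ℝ) ^ 2) := by
      calc ((P \ Sm).card : ℝ) * (128 * (r : ℝ) ^ 2) ≤ ((P \ Sm).card : ℝ) * Real.log y :=
            mul_le_mul_of_nonneg_left hlogy (Nat.cast_nonneg _)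
        _ ≤ 32 * r ^ 2 * Real.log u := h1.trans h2
        _ ≤ 32 * r ^ 2 * (2 * y) := by gcongr
        _ = _ := by ring
    exact le_of_mul_le_mul_right h3 (by positivity)
  have hfin : (∑ q ∈ P \ Sm, ((S0.filter fun k : ℕ => (k : ZMod p) ^ ((p - 1) / q) = 1).card : ℝ))
      < S0.card := by
    have hb0 : 0 ≤ (H : ℝ) / Q / y + E * H / u ^ 3 := by
      have : 0 ≤ E := by linarith
      positivity
    calc _ ≤ ((P \ Sm).card : ℝ) * ((H : ℝ) / Q / y + E * H / u ^ 3) := by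
          rw [← nsmul_eq_mul]
          exact Finset.sum_le_card_nsmul _ _ _ hbad
      _ ≤ (y / 2) * ((H : ℝ) / Q / y + E * H / u ^ 3) := by gcongr
      _ = (H : ℝ) / Q / 2 + (y / 2) * (E * H / u ^ 3) := by field_simp
      _ < (H : ℝ) / Q - E * H / u ^ 3 := by
          have h1 : (H : ℝ) / u ^ 2 ≤ H / Q := by gcongr
          have h2 : E * H / u ^ 3 * (2 + y) < H / u ^ 2 := by
            have h3 : E * (2 + y) < u := by
              refine lt_of_le_of_lt ?_ hEu
              have : 0 ≤ E := by linarith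
              gcongr
            have h4 : E * H / u ^ 3 * (2 + y) = (H / u ^ 3) * (E * (2 + y)) := by ring
            have h5 : (H : ℝ) / u ^ 2 = (H / u ^ 3) * u := by field_simp
            rw [h4, h5]
            gcongr
          linarith
      _ ≤ _ := hmain
  exact_mod_cast hfin

lemma lpr_le (p k : ℕ) [Fact p.Prime] (hk1 : 1 ≤ k) (hkp : k < p)
    (hord : orderOf (k : ZMod p) = p - 1) : leastPrimitiveRoot p ≤ k := by
  refine Nat.sInf_le ⟨hk1, hkp, ?_⟩
  intro x hx
  have hp2 := (Fact.out : p.Prime).two_le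
  have hprim : IsPrimitiveRoot (k : ZMod p) (p - 1) := hord ▸ IsPrimitiveRoot.orderOf _
  have : NeZero (p - 1) := ⟨by omega⟩
  obtain ⟨i, -, hi⟩ := hprim.eq_pow_of_pow_eq_one (ZMod.pow_card_sub_one_eq_one hx)
  exact ⟨i, hi⟩

lemma lpr_le_self (p : ℕ) : leastPrimitiveRoot p ≤ p := by
  unfold leastPrimitiveRoot
  rcases Set.eq_empty_or_nonempty
    {g : ℕ | 1 ≤ g ∧ g < p ∧ ∀ x : ZMod p, x ≠ 0 → ∃ k : ℕ, (g : ZMod p) ^ k = x} with h | h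
  · rw [h, Nat.sInf_empty]; exact Nat.zero_le _
  · exact (Nat.sInf_mem h).2.1.le

/-- Burgess's bound: for every `ε > 0` there is `C > 0` such that the least
primitive root modulo any prime `p` is at most `C · p^(1/4 + ε)`. -/
theorem leastPrimitiveRoot_bound :
    ∀ ε : ℝ, 0 < ε → ∃ C : ℝ, 0 < C ∧ ∀ p : ℕ, p.Prime →
      (leastPrimitiveRoot p : ℝ) ≤ C * (p : ℝ) ^ ((1 : ℝ) / 4 + ε) := by
  intro ε hε
  obtain ⟨r, hr4, hrε⟩ : ∃ r : ℕ, 4 ≤ r ∧ 1 / (r : ℝ) ≤ ε := by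
    obtain ⟨r', hr'⟩ := exists_nat_ge (1 / ε)
    refine ⟨r' + 4, by omega, ?_⟩
    rw [div_le_iff₀ (by positivity)]
    rw [div_le_iff₀ hε] at hr'
    push_cast
    nlinarith
  have hr0 : (0 : ℝ) < r := by exact_mod_cast (by omega : 0 < r)
  obtain ⟨u0, hu0⟩ := exists_small_root r hr4
  refine ⟨max 1 (u0 ^ (32 * r ^ 2)), lt_max_of_lt_left one_pos, ?_⟩
  intro p hp
  have : Fact p.Prime := ⟨hp⟩
  have hp1 : (1 : ℝ) < p := by exact_mod_cast hp.one_lt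
  have hp0 : (0 : ℝ) < p := by linarith
  have hpow1 : 1 ≤ (p : ℝ) ^ ((1 : ℝ) / 4 + ε) := Real.one_le_rpow hp1.le (by positivity)
  set u : ℝ := (p : ℝ) ^ (1 / (32 * (r : ℝ) ^ 2)) with hu
  have hupos : 0 < u := by positivity
  have hu1 : 1 < u := Real.one_lt_rpow hp1 (by positivity)
  have hup : u ^ (32 * r ^ 2) = p := by
    rw [hu, ← Real.rpow_natCast, ← Real.rpow_mul hp0.le]
    conv_rhs => rw [← Real.rpow_one (p : ℝ)]
    congr 1
    push_cast
    field_simp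
  by_cases hcase : u0 ≤ u
  · obtain ⟨k, hk, hord⟩ := hu0 p u hcase hup
    rw [Finset.mem_Icc] at hk
    have hkle : (k : ℝ) ≤ (u ^ 4) ^ (2 * r ^ 2 + 8 * r) :=
      (Nat.cast_le.2 hk.2).trans (Nat.floor_le (by positivity))
    have hkp : k < p := by
      have : (k : ℝ) < p := by
        have hexp : 4 * (2 * r ^ 2 + 8 * r) < 32 * r ^ 2 := by nlinarith
        calc (k : ℝ) ≤ (u ^ 4) ^ (2 * r ^ 2 + 8 * r) := hkle
          _ = u ^ (4 * (2 * r ^ 2 + 8 * r)) := by rw [← pow_mul]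
          _ < u ^ (32 * r ^ 2) := pow_lt_pow_right₀ hu1 hexp
          _ = p := hup
      exact_mod_cast this
    have h1 : (leastPrimitiveRoot p : ℝ) ≤ k := by exact_mod_cast lpr_le p k hk.1 hkp hord
    have h2 : (u ^ 4) ^ (2 * r ^ 2 + 8 * r) = (p : ℝ) ^ ((1 : ℝ) / 4 + 1 / r) := by
      rw [← pow_mul, hu, ← Real.rpow_natCast, ← Real.rpow_mul hp0.le]
      congr 1
      push_cast
      field_simp
      ring
    have h3 : (p : ℝ) ^ ((1 : ℝ) / 4 + 1 / r) ≤ (p : ℝ) ^ ((1 : ℝ) / 4 + ε) :=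
      Real.rpow_le_rpow_of_exponent_le hp1.le (by linarith)
    have h4 : (p : ℝ) ^ ((1 : ℝ) / 4 + ε) ≤
        max 1 (u0 ^ (32 * r ^ 2)) * (p : ℝ) ^ ((1 : ℝ) / 4 + ε) :=
      le_mul_of_one_le_left (by positivity) (le_max_left _ _)
    linarith
  · rw [not_le] at hcase
    have h1 : (leastPrimitiveRoot p : ℝ) ≤ p := by exact_mod_cast lpr_le_self p
    have h2 : (p : ℝ) ≤ max 1 (u0 ^ (32 * r ^ 2)) := by
      refine le_trans ?_ (le_max_right _ _)
      rw [← hup]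
      gcongr
    calc (leastPrimitiveRoot p : ℝ) ≤ max 1 (u0 ^ (32 * r ^ 2)) * 1 := by linarith
      _ ≤ _ := by gcongr
end
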